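/- arXiv:0811.2324 — 4 statements merged into one kernel-verified Lean document; each statement's English description precedes it below -/
import Mathlib

section
/- Let C be a Coxeter element of the Weyl group W of the root system R of g. Then the linear map 1−C is invertible on V, and setting ⟨x,y⟩ = ((1−C)^{-1}x, y), the numbers ⟨α,β⟩ are integers for all α, β ∈ R. Moreover, there exists a family (E_α)_{α∈R} with each E_α a nonzero vector of the root space g_α such that for all α, β ∈ R: [E_α, E_β] = (−1)^{⟨α,β⟩} E_{α+β} whenever α+β ∈ R, and [E_α, E_β] = 0 whenever α+β ∉ R and α ≠ −β. -/
open RealInnerProductSpace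

variable {V : Type*} [NormedAddCommGroup V] [InnerProductSpace ℝ V] [FiniteDimensional ℝ V]

/-- The reflection in the hyperplane orthogonal to a vector `α` with `⟪α, α⟫ = 2`,
as a linear map: `x ↦ x - ⟪α, x⟫ α`. -/
noncomputable def reflLM (α : V) : V →ₗ[ℝ] V :=
  LinearMap.id - ((innerSL ℝ α).toLinearMap).smulRight α

/-- `R` is an irreducible simply-laced (crystallographic, with all roots of squared
length 2) finite root system spanning `V`. -/
structure IsSimplyLacedRootSystem (R : Finset V) : Prop where
  zero_not_mem : (0 : V) ∉ R
  span_top : Submodule.span ℝ (R : Set V) = ⊤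
  norm_two : ∀ α ∈ R, ⟪α, α⟫ = (2 : ℝ)
  inner_int : ∀ α ∈ R, ∀ β ∈ R, ∃ n : ℤ, ⟪α, β⟫ = (n : ℝ)
  reflect_mem : ∀ α ∈ R, ∀ β ∈ R, reflLM α β ∈ R
  irreducible : ∀ S ⊆ R, (∀ α ∈ S, ∀ β ∈ R, β ∉ S → ⟪α, β⟫ = 0) → S = ∅ ∨ S = R

/-- `Δ` is a base (system of simple roots) of the root system `R`: it consists of
roots, it is a linearly independent spanning set, and every root is a nonnegative or
nonpositive integral combination of elements of `Δ`. -/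
def IsBase (R : Finset V) (Δ : Set V) : Prop :=
  Δ ⊆ (R : Set V) ∧
  LinearIndependent ℝ (Subtype.val : Δ → V) ∧
  Submodule.span ℝ Δ = ⊤ ∧
  ∀ β ∈ R, β ∈ AddSubmonoid.closure Δ ∨ -β ∈ AddSubmonoid.closure Δ

/-- A Coxeter element of the Weyl group of `R`: a product of the simple reflections
with respect to some base of `R`, each occurring exactly once. -/
def IsCoxeterElement (R : Finset V) (C : V →ₗ[ℝ] V) : Prop :=
  ∃ l : List V, l.Nodup ∧ IsBase R {x | x ∈ l} ∧ C = (l.map reflLM).prod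

variable {L : Type*} [LieRing L] [LieAlgebra ℂ L] [FiniteDimensional ℂ L]

/-- `gsp` is the root-space decomposition of the finite-dimensional simple complex Lie
algebra `L` with respect to the splitting Cartan subalgebra `H`, with the roots recorded
as the finite set `R ⊂ V` (the real span of the roots) and `χ α : H → ℂ` the complex
linear functional corresponding to `α ∈ R`. -/
structure IsRootSpaceDecomposition (R : Finset V) (H : LieSubalgebra ℂ L)
    (χ : V → H → ℂ) (gsp : V → Submodule ℂ L) : Prop where
  simple : LieAlgebra.IsSimple ℂ L
  cartan : H.IsCartanSubalgebra
  root_space_iff : ∀ α ∈ R, ∀ x : L,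
    x ∈ gsp α ↔ ∀ h : H, ⁅(h : L), x⁆ = χ α h • x
  χ_ne : ∀ α ∈ R, χ α ≠ 0
  finrank_eq_one : ∀ α ∈ R, Module.finrank ℂ (gsp α) = 1
  decomp : H.toSubmodule ⊔ (⨆ α ∈ R, gsp α) = ⊤
  bracket_mem : ∀ α ∈ R, ∀ β ∈ R, α + β ∈ R →
    ∀ x ∈ gsp α, ∀ y ∈ gsp β, ⁅x, y⁆ ∈ gsp (α + β)
  bracket_ne_zero : ∀ α ∈ R, ∀ β ∈ R, α + β ∈ R →
    ∀ x ∈ gsp α, x ≠ 0 → ∀ y ∈ gsp β, y ≠ 0 → ⁅x, y⁆ ≠ 0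
  bracket_eq_zero : ∀ α ∈ R, ∀ β ∈ R, α + β ∉ R → α + β ≠ 0 →
    ∀ x ∈ gsp α, ∀ y ∈ gsp β, ⁅x, y⁆ = 0

section Aux
set_option linter.unusedSectionVars false
theorem reflLM_apply' (a x : V) : reflLM a x = x - ⟪a, x⟫ • a := by
  simp [reflLM]

theorem cox_functional (φ : V →ₗ[ℝ] ℝ) (t : List V) (h : ∀ b ∈ t, φ b = 0) (y : V) :
    φ ((t.map reflLM).prod y) = φ y := by
  induction t with
  | nil => simp
  | cons a t ih =>
    simp only [List.map_cons, List.prod_cons, Module.End.mul_apply, reflLM_apply', map_sub,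
      map_smul]
    rw [ih (fun b hb => h b (List.mem_cons_of_mem _ hb)), h a List.mem_cons_self]
    simp

open Classical in
theorem cox_key (G : AddSubgroup ℝ) (φ : V → V →ₗ[ℝ] ℝ) (m : V → ℝ) (y : V) (l : List V)
    (hnd : l.Nodup)
    (hφ : ∀ a ∈ l, ∀ b ∈ l, φ a b = if a = b then 1 else 0)
    (hint : ∀ a ∈ l, ∀ b ∈ l, ∃ n : ℤ, ⟪a, b⟫ = (n : ℝ))
    (hm : ∀ a ∈ l, m a ∈ G)
    (hy : y - (l.map reflLM).prod y = (l.map (fun a => m a • a)).sum) :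
    ∀ a ∈ l, ⟪a, y⟫ ∈ G := by
  induction l with
  | nil => simp
  | cons a t ih =>
    have hat : a ∉ t := (List.nodup_cons.1 hnd).1
    have hzero : ∀ b ∈ t, φ a b = 0 := fun b hb => by
      rw [hφ a List.mem_cons_self b (List.mem_cons_of_mem _ hb), if_neg]
      rintro rfl
      exact hat hb
    set z := (t.map reflLM).prod y with hz
    have h1 : φ a z = φ a y := cox_functional (φ a) t hzero y
    have h2 : φ a ((t.map (fun a => m a • a)).sum) = 0 := by
      have : ∀ s : List V, (∀ b ∈ s, φ a b = 0) → φ a ((s.map (fun a => m a • a)).sum) = 0 := by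
        intro s
        induction s with
        | nil => simp
        | cons c s ihs =>
          intro h
          simp only [List.map_cons, List.sum_cons, map_add, map_smul]
          rw [ihs (fun b hb => h b (List.mem_cons_of_mem _ hb)), h c List.mem_cons_self]
          simp
      exact this t hzero
    simp only [List.map_cons, List.prod_cons, Module.End.mul_apply, reflLM_apply',
      List.sum_cons] at hy
    rw [← hz] at hy
    have h3 := congrArg (φ a) hy
    simp only [map_sub, map_smul, map_add, h1, h2,
      hφ a List.mem_cons_self a List.mem_cons_self, if_true, smul_eq_mul, mul_one] at h3
    have h4 : ⟪a, z⟫ = m a := by linarith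
    have h5 : y - z = (t.map (fun a => m a • a)).sum := by
      rw [h4] at hy
      have : y - z = (y - (z - m a • a)) - m a • a := by abel
      rw [this, hy]; abel
    have iht := ih (List.nodup_cons.1 hnd).2
      (fun b hb c hc => hφ b (List.mem_cons_of_mem _ hb) c (List.mem_cons_of_mem _ hc))
      (fun b hb c hc => hint b (List.mem_cons_of_mem _ hb) c (List.mem_cons_of_mem _ hc))
      (fun b hb => hm b (List.mem_cons_of_mem _ hb)) h5
    intro b hb
    rcases List.mem_cons.1 hb with rfl | hb
    · have h6 : ⟪b, y⟫ = m b + ⟪b, (t.map (fun a => m a • a)).sum⟫ := by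
        rw [← h5, inner_sub_right, h4]; ring
      rw [h6]
      refine G.add_mem (hm b List.mem_cons_self) ?_
      have : ∀ s : List V, (∀ c ∈ s, c ∈ t) → ⟪b, (s.map (fun a => m a • a)).sum⟫ ∈ G := by
        intro s
        induction s with
        | nil => simp [G.zero_mem]
        | cons c s ihs =>
          intro h
          simp only [List.map_cons, List.sum_cons, inner_add_right, inner_smul_right]
          refine G.add_mem ?_ (ihs (fun c hc => h c (List.mem_cons_of_mem _ hc)))
          have hc : c ∈ t := h c List.mem_cons_self
          obtain ⟨n, hn⟩ := hint b List.mem_cons_self c (List.mem_cons_of_mem _ hc)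
          rw [hn, mul_comm, ← zsmul_eq_mul]
          exact G.zsmul_mem (hm c (List.mem_cons_of_mem _ hc)) n
      exact this t (fun c hc => hc)
    · exact iht b hb

theorem cox_isometry (l : List V) (h2 : ∀ a ∈ l, ⟪a, a⟫ = (2 : ℝ)) (x y : V) :
    ⟪(l.map reflLM).prod x, (l.map reflLM).prod y⟫ = ⟪x, y⟫ := by
  induction l with
  | nil => simp
  | cons a t ih =>
    simp only [List.map_cons, List.prod_cons, Module.End.mul_apply, reflLM_apply']
    rw [← ih (fun b hb => h2 b (List.mem_cons_of_mem _ hb))]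
    simp only [inner_sub_left, inner_sub_right, inner_smul_left, inner_smul_right,
      h2 a List.mem_cons_self, real_inner_comm a]
    simp
    ring

theorem cox_main (R : Finset V) (hR : IsSimplyLacedRootSystem R)
    (C : V →ₗ[ℝ] V) (hC : IsCoxeterElement R C) :
    (∃ f : V →ₗ[ℝ] ℝ, ∀ β ∈ R, ∃ n : ℕ, 0 < n ∧ (f β = n ∨ f β = -n)) ∧
    ∃ D : V →ₗ[ℝ] V, D * ((1 : V →ₗ[ℝ] V) - C) = 1 ∧ ((1 : V →ₗ[ℝ] V) - C) * D = 1 ∧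
      (∀ α ∈ R, ∀ β ∈ R, ∃ n : ℤ, ⟪D α, β⟫ = (n : ℝ)) ∧
      (∀ x y, ⟪D x, y⟫ + ⟪D y, x⟫ = ⟪x, y⟫) := by
  classical
  obtain ⟨l, hnd, ⟨hsub, hli, hsp, hcl⟩, rfl⟩ := hC
  let b : Module.Basis {x | x ∈ l} ℝ V := Module.Basis.mk hli (by
    rw [Subtype.range_val]; exact hsp.ge)
  have hb : ∀ i, b i = i.1 := fun i => by simp [b]
  constructor
  · refine ⟨b.constr ℝ (fun _ => (1 : ℝ)), ?_⟩
    have hf : ∀ a ∈ l, (b.constr ℝ (fun _ => (1 : ℝ))) a = 1 := by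
      intro a ha
      have := b.constr_basis ℝ (fun _ => (1 : ℝ)) ⟨a, ha⟩
      rwa [hb] at this
    set f := b.constr ℝ (fun _ => (1 : ℝ)) with hfdef
    have key : ∀ x ∈ AddSubmonoid.closure {x | x ∈ l}, ∃ n : ℕ, f x = n ∧ (n = 0 → x = 0) := by
      intro x hx
      induction hx using AddSubmonoid.closure_induction with
      | mem x hx => exact ⟨1, by simp [hf x hx], by simp⟩
      | zero => exact ⟨0, by simp, by simp⟩
      | add x y _ _ hx hy =>
        obtain ⟨n, hn, hn'⟩ := hx
        obtain ⟨k, hk, hk'⟩ := hy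
        refine ⟨n + k, by simp [hn, hk], fun h => ?_⟩
        rw [hn' (by omega), hk' (by omega), add_zero]
    intro β hβ
    have hβ0 : β ≠ 0 := fun h => hR.zero_not_mem (h ▸ hβ)
    rcases hcl β hβ with h | h
    · obtain ⟨n, hn, hn'⟩ := key _ h
      exact ⟨n, Nat.pos_of_ne_zero fun h => hβ0 (hn' h), Or.inl hn⟩
    · obtain ⟨n, hn, hn'⟩ := key _ h
      refine ⟨n, Nat.pos_of_ne_zero fun h => hβ0 (neg_eq_zero.1 (hn' h)), Or.inr ?_⟩
      rw [map_neg] at hn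
      linarith
  · set C := (l.map reflLM).prod with hCdef
    let φ : V → V →ₗ[ℝ] ℝ := fun a => if h : a ∈ l then b.coord ⟨a, h⟩ else 0
    have hφ : ∀ a ∈ l, ∀ c ∈ l, φ a c = if a = c then 1 else 0 := by
      intro a ha c hc
      simp only [φ, dif_pos ha]
      have : c = b ⟨c, hc⟩ := by rw [hb]
      conv_lhs => rw [this]
      rw [Module.Basis.coord_apply, Module.Basis.repr_self, Finsupp.single_apply]
      simp only [Subtype.mk.injEq, eq_comm]
    have hint : ∀ a ∈ l, ∀ b ∈ l, ∃ n : ℤ, ⟪a, b⟫ = (n : ℝ) :=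
      fun a ha b hb => hR.inner_int a (hsub ha) b (hsub hb)
    have hinj : Function.Injective ((1 : V →ₗ[ℝ] V) - C) := by
      rw [← LinearMap.ker_eq_bot, LinearMap.ker_eq_bot']
      intro y hy
      have := cox_key ⊥ φ (fun _ => 0) y l hnd hφ hint (fun _ _ => by simp) (by
        simpa using hy)
      have hy' : ∀ x ∈ Submodule.span ℝ {x | x ∈ l}, ⟪x, y⟫ = 0 := by
        intro x hx
        induction hx using Submodule.span_induction with
        | mem x hx => simpa using this x hx
        | zero => simp
        | add x y _ _ hx hy => rw [inner_add_left, hx, hy, add_zero]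
        | smul c x _ hx => rw [inner_smul_left, hx, mul_zero]
      exact inner_self_eq_zero.1 (hy' y (hsp ▸ Submodule.mem_top))
    let e := LinearEquiv.ofInjectiveEndo ((1 : V →ₗ[ℝ] V) - C) hinj
    have he1 : ∀ x, e.symm (((1 : V →ₗ[ℝ] V) - C) x) = x := fun x => e.symm_apply_apply x
    have he2 : ∀ x, ((1 : V →ₗ[ℝ] V) - C) (e.symm x) = x := fun x => e.apply_symm_apply x
    refine ⟨e.symm.toLinearMap, LinearMap.ext he1, LinearMap.ext he2, ?_, ?_⟩
    · have hco : ∀ α ∈ AddSubmonoid.closure {x | x ∈ l}, ∃ m : V → ℤ,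
          α = (l.map (fun a => (m a : ℝ) • a)).sum := by
        intro x hx
        induction hx using AddSubmonoid.closure_induction with
        | mem x hx =>
          refine ⟨fun a => if a = x then 1 else 0, ?_⟩
          have : ∀ s : List V, s.Nodup → (s.map (fun a => (((if a = x then 1 else 0 : ℤ)) : ℝ) • a)).sum
              = if x ∈ s then x else 0 := by
            intro s
            induction s with
            | nil => simp
            | cons c s ih =>
              intro hs
              have hs' := List.nodup_cons.1 hs
              simp only [List.map_cons, List.sum_cons]
              rw [ih hs'.2]
              by_cases hcx : c = x
              · subst hcx
                simp [hs'.1]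
              · have : x ≠ c := fun h => hcx h.symm
                simp [hcx, this]
          rw [this l hnd, if_pos (show x ∈ l from hx)]
        | zero => exact ⟨0, by simp⟩
        | add x y _ _ hx hy =>
          obtain ⟨m, hm⟩ := hx
          obtain ⟨k, hk⟩ := hy
          refine ⟨m + k, ?_⟩
          conv_lhs => rw [hm, hk]
          rw [← List.sum_map_add]
          simp [add_smul]
      have hco' : ∀ α ∈ R, ∃ m : V → ℤ, α = (l.map (fun a => (m a : ℝ) • a)).sum := by
        intro α hα
        rcases hcl α hα with h | h
        · exact hco α h
        · obtain ⟨m, hm⟩ := hco _ h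
          refine ⟨-m, ?_⟩
          rw [eq_comm, ← neg_eq_iff_eq_neg] at hm
          rw [← hm]
          have : ∀ s : List V, -(s.map (fun a => (m a : ℝ) • a)).sum =
            (s.map (fun a => ((-m) a : ℝ) • a)).sum := by
            intro s
            induction s with
            | nil => simp
            | cons c s ih =>
              simp only [List.map_cons, List.sum_cons, neg_add, ih]
              simp
          simpa using this l
      intro α hα
      obtain ⟨m, hm⟩ := hco' α hα
      have hk := cox_key (Int.castAddHom ℝ).range φ (fun a => (m a : ℝ)) (e.symm α) l hnd hφ hint
        (fun a _ => ⟨m a, rfl⟩) (by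
          rw [← hm]
          exact he2 α)
      have hcc : ∀ x ∈ AddSubmonoid.closure {x | x ∈ l}, ∃ n : ℤ, ⟪e.symm α, x⟫ = (n : ℝ) := by
        intro x hx
        induction hx using AddSubmonoid.closure_induction with
        | mem x hx =>
          obtain ⟨n, hn⟩ := hk x hx
          exact ⟨n, by rw [real_inner_comm]; exact hn.symm⟩
        | zero => exact ⟨0, by simp⟩
        | add x y _ _ hx hy =>
          obtain ⟨m, hm⟩ := hx
          obtain ⟨k, hk⟩ := hy
          exact ⟨m + k, by rw [inner_add_right, hm, hk]; simp⟩
      intro β hβ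
      rcases hcl β hβ with h | h
      · exact hcc β h
      · obtain ⟨n, hn⟩ := hcc _ h
        rw [inner_neg_right] at hn
        exact ⟨-n, by push_cast; rw [← hn, neg_neg]⟩
    · intro x y
      obtain ⟨u, rfl⟩ : ∃ u, ((1 : V →ₗ[ℝ] V) - C) u = x := ⟨_, he2 x⟩
      obtain ⟨v, rfl⟩ : ∃ u, ((1 : V →ₗ[ℝ] V) - C) u = y := ⟨_, he2 y⟩
      simp only [LinearEquiv.coe_coe, he1]
      have := cox_isometry l (fun a ha => hR.norm_two a (hsub ha)) u v
      rw [← hCdef] at this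
      simp only [LinearMap.sub_apply, Module.End.one_apply, inner_sub_left, inner_sub_right, this,
        real_inner_comm u v, real_inner_comm u (C v), real_inner_comm v (C u)]
      ring

theorem rt_neg {R : Finset V} (hR : IsSimplyLacedRootSystem R) {α : V} (hα : α ∈ R) : -α ∈ R := by
  have := hR.reflect_mem α hα α hα
  rw [reflLM_apply', hR.norm_two α hα, two_smul] at this
  convert this using 1
  abel

theorem rt_add_iff {R : Finset V} (hR : IsSimplyLacedRootSystem R) {α β : V} (hα : α ∈ R)
    (hβ : β ∈ R) : α + β ∈ R ↔ ⟪α, β⟫ = (-1 : ℝ) := by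
  constructor
  · intro h
    have := hR.norm_two _ h
    rw [inner_add_left, inner_add_right, inner_add_right, hR.norm_two α hα, hR.norm_two β hβ,
      real_inner_comm α β] at this
    linarith
  · intro h
    have := hR.reflect_mem α hα β hβ
    rw [reflLM_apply', h, neg_one_smul, sub_neg_eq_add, add_comm] at this
    exact this

theorem rt_sub {R : Finset V} (hR : IsSimplyLacedRootSystem R) {α β : V} (hα : α ∈ R)
    (hβ : β ∈ R) (h : ⟪α, β⟫ = (1 : ℝ)) : α - β ∈ R := by
  rw [sub_eq_add_neg]
  refine (rt_add_iff hR hα (rt_neg hR hβ)).2 ?_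
  rw [inner_neg_right, h]

theorem rt_cases {R : Finset V} (hR : IsSimplyLacedRootSystem R) {α β : V} (hα : α ∈ R)
    (hβ : β ∈ R) : α = -β ∨ ⟪α, β⟫ = (-1 : ℝ) ∨ ⟪α, β⟫ = (0 : ℝ) ∨ ⟪α, β⟫ = (1 : ℝ) ∨ α = β := by
  obtain ⟨n, hn⟩ := hR.inner_int α hα β hβ
  have h1 : ⟪α + β, α + β⟫ = 4 + 2 * (n : ℝ) := by
    rw [inner_add_left, inner_add_right, inner_add_right, hR.norm_two α hα, hR.norm_two β hβ,
      real_inner_comm α β, hn]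
    ring
  have h2 : ⟪α - β, α - β⟫ = 4 - 2 * (n : ℝ) := by
    rw [inner_sub_left, inner_sub_right, inner_sub_right, hR.norm_two α hα, hR.norm_two β hβ,
      real_inner_comm α β, hn]
    ring
  have h3 : (0 : ℝ) ≤ ⟪α + β, α + β⟫ := real_inner_self_nonneg
  have h4 : (0 : ℝ) ≤ ⟪α - β, α - β⟫ := real_inner_self_nonneg
  rw [h1] at h3
  rw [h2] at h4
  have h5 : -2 ≤ n := by
    have : (-2 : ℝ) ≤ n := by linarith
    exact_mod_cast this
  have h6 : n ≤ 2 := by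
    have : (n : ℝ) ≤ 2 := by linarith
    exact_mod_cast this
  rw [hn]
  interval_cases n
  · left
    norm_num at h1
    exact eq_neg_of_add_eq_zero_left h1
  · norm_num
  · norm_num
  · norm_num
  · norm_num at h2
    have := sub_eq_zero.1 h2
    tauto

/-- Properties of the sign cocycle. -/
structure EpsOK (R : Finset V) (ε : V → V → ℂ) : Prop where
  sq : ∀ α β, ε α β * ε α β = 1
  addl : ∀ α ∈ R, ∀ β ∈ R, ∀ γ ∈ R, α + β ∈ R → ε (α + β) γ = ε α γ * ε β γ
  addr : ∀ α ∈ R, ∀ β ∈ R, ∀ γ ∈ R, α + β ∈ R → ε γ (α + β) = ε γ α * ε γ β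
  negl : ∀ α ∈ R, ∀ β ∈ R, ε (-α) β = ε α β
  negr : ∀ α ∈ R, ∀ β ∈ R, ε α (-β) = ε α β
  self : ∀ α ∈ R, ε α α = -1
  skew : ∀ α ∈ R, ∀ β ∈ R, α + β ∈ R → ε β α = - ε α β

theorem eps_exists (R : Finset V) (hR : IsSimplyLacedRootSystem R) (D : V →ₗ[ℝ] V)
    (hint : ∀ α ∈ R, ∀ β ∈ R, ∃ n : ℤ, ⟪D α, β⟫ = (n : ℝ))
    (hsum : ∀ x y, ⟪D x, y⟫ + ⟪D y, x⟫ = ⟪x, y⟫) :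
    ∃ ε : V → V → ℂ, EpsOK R ε ∧
      ∀ α ∈ R, ∀ β ∈ R, ∀ n : ℤ, ⟪D α, β⟫ = (n : ℝ) → ε α β = (-1 : ℂ) ^ n := by
  have hval : ∀ α β : V, ∀ n : ℤ, ⟪D α, β⟫ = (n : ℝ) →
      (-1 : ℂ) ^ ⌊⟪D α, β⟫⌋ = (-1 : ℂ) ^ n := by
    intro α β n h
    rw [h, Int.floor_intCast]
  have h0 : (-1 : ℂ) ≠ 0 := by norm_num
  refine ⟨fun α β => (-1 : ℂ) ^ ⌊⟪D α, β⟫⌋, ?_, fun α _ β _ n hn => hval α β n hn⟩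
  constructor
  · intro α β
    rw [← mul_zpow]; norm_num
  · intro α hα β hβ γ hγ _
    obtain ⟨n, hn⟩ := hint α hα γ hγ
    obtain ⟨m, hm⟩ := hint β hβ γ hγ
    try simp only
    rw [hval α γ n hn, hval β γ m hm, ← zpow_add₀ h0]
    exact hval _ _ _ (by rw [map_add, inner_add_left, hn, hm]; push_cast; rfl)
  · intro α hα β hβ γ hγ _
    obtain ⟨n, hn⟩ := hint γ hγ α hα
    obtain ⟨m, hm⟩ := hint γ hγ β hβ
    try simp only
    rw [hval γ α n hn, hval γ β m hm, ← zpow_add₀ h0]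
    exact hval _ _ _ (by rw [inner_add_right, hn, hm]; push_cast; rfl)
  · intro α hα β hβ
    obtain ⟨n, hn⟩ := hint α hα β hβ
    try simp only
    rw [hval α β n hn, hval (-α) β (-n) (by rw [map_neg, inner_neg_left, hn]; push_cast; rfl)]
    rw [zpow_neg, ← inv_zpow]; norm_num
  · intro α hα β hβ
    obtain ⟨n, hn⟩ := hint α hα β hβ
    try simp only
    rw [hval α β n hn, hval α (-β) (-n) (by rw [inner_neg_right, hn]; push_cast; rfl)]
    rw [zpow_neg, ← inv_zpow]; norm_num
  · intro α hα
    have := hsum α α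
    rw [hR.norm_two α hα] at this
    try simp only
    rw [hval α α 1 (by push_cast; linarith)]
    norm_num
  · intro α hα β hβ hαβ
    obtain ⟨n, hn⟩ := hint α hα β hβ
    have := hsum α β
    rw [(rt_add_iff hR hα hβ).1 hαβ] at this
    try simp only
    rw [hval α β n hn, hval β α (-n + -1) (by push_cast; linarith), zpow_add₀ h0, zpow_neg,
      ← inv_zpow]
    norm_num

section Lie
variable {R : Finset V} {H : LieSubalgebra ℂ L} {χ : V → H → ℂ} {gsp : V → Submodule ℂ L}

/-- A choice of nonzero root vectors. -/
def GoodFam (R : Finset V) (gsp : V → Submodule ℂ L) (E : V → L) : Prop :=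
  ∀ α ∈ R, E α ∈ gsp α ∧ E α ≠ 0

theorem gf_coef (hg : IsRootSpaceDecomposition R H χ gsp) {E : V → L} (hE : GoodFam R gsp E)
    {α β γ : V} (hα : α ∈ R) (hβ : β ∈ R) (hγ : γ ∈ R) (h : α + β = γ) :
    ∃ c : ℂ, c ≠ 0 ∧ ⁅E α, E β⁆ = c • E γ := by
  subst h
  have h1 := hg.bracket_mem α hα β hβ hγ _ (hE α hα).1 _ (hE β hβ).1
  have h2 := hg.bracket_ne_zero α hα β hβ hγ _ (hE α hα).1 (hE α hα).2 _ (hE β hβ).1 (hE β hβ).2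
  have h3 := (finrank_eq_one_iff_of_nonzero' (⟨E (α + β), (hE _ hγ).1⟩ : gsp (α + β))
    (by simpa using (hE _ hγ).2)).1 (hg.finrank_eq_one _ hγ) ⟨_, h1⟩
  obtain ⟨c, hc⟩ := h3
  have hc' : c • E (α + β) = ⁅E α, E β⁆ := congrArg Subtype.val hc
  refine ⟨c, ?_, hc'.symm⟩
  rintro rfl
  rw [zero_smul] at hc'
  exact h2 hc'.symm

theorem gf_zero (hR : IsSimplyLacedRootSystem R) (hg : IsRootSpaceDecomposition R H χ gsp)
    {E : V → L} (hE : GoodFam R gsp E)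
    {α β : V} (hα : α ∈ R) (hβ : β ∈ R) (h : ⟪α, β⟫ = (0 : ℝ) ∨ ⟪α, β⟫ = (1 : ℝ)) :
    ⁅E α, E β⁆ = 0 := by
  refine hg.bracket_eq_zero α hα β hβ ?_ ?_ _ (hE α hα).1 _ (hE β hβ).1
  · rw [rt_add_iff hR hα hβ]
    rcases h with h | h <;> rw [h] <;> norm_num
  · intro h'
    rw [eq_neg_of_add_eq_zero_left h', inner_neg_left, hR.norm_two β hβ] at h
    norm_num at h

theorem gf_A0 (hR : IsSimplyLacedRootSystem R) (hg : IsRootSpaceDecomposition R H χ gsp)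
    {E : V → L} (hE : GoodFam R gsp E)
    {α β : V} (hα : α ∈ R) (hβ : β ∈ R) (h : ⟪α, β⟫ = (-1 : ℝ)) {c d : ℂ}
    (hc : ⁅E α, E β⁆ = c • E (α + β)) (hd : ⁅E (α + β), E (-α)⁆ = d • E β) :
    ⁅⁅E α, E (-α)⁆, E β⁆ = (c * d) • E β ∧
    ⁅⁅E α, E (-α)⁆, E (α + β)⁆ = (-(c * d)) • E (α + β) := by
  have hab := (rt_add_iff hR hα hβ).2 h
  have hd' : ⁅E (-α), E (α + β)⁆ = -(d • E β) := by rw [← lie_skew, hd]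
  constructor
  · rw [lie_lie, hc, gf_zero hR hg hE (rt_neg hR hα) hβ (by rw [inner_neg_left, h]; norm_num),
      lie_smul, hd', lie_zero, zero_sub, smul_neg, neg_neg, smul_smul]
  · rw [lie_lie, hd', gf_zero hR hg hE hα hab (by
      rw [inner_add_right, h, hR.norm_two α hα]; norm_num), lie_neg, lie_smul, hc, lie_zero,
      sub_zero, smul_smul, neg_smul, mul_comm]

theorem gf_A1 (hR : IsSimplyLacedRootSystem R) (hg : IsRootSpaceDecomposition R H χ gsp)
    {E : V → L} (hE : GoodFam R gsp E)
    {α β : V} (hα : α ∈ R) (hβ : β ∈ R) (h : ⟪α, β⟫ = (-1 : ℝ)) :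
    ∃ y : ℂ, y ≠ 0 ∧ ⁅⁅E α, E (-α)⁆, E β⁆ = y • E β ∧
    ⁅⁅E α, E (-α)⁆, E (α + β)⁆ = (-y) • E (α + β) := by
  have hab := (rt_add_iff hR hα hβ).2 h
  obtain ⟨c, hc0, hc⟩ := gf_coef hg hE hα hβ hab rfl
  obtain ⟨d, hd0, hd⟩ := gf_coef hg hE hab (rt_neg hR hα) hβ (by abel)
  exact ⟨c * d, mul_ne_zero hc0 hd0, gf_A0 hR hg hE hα hβ h hc hd⟩

theorem gf_additive (hg : IsRootSpaceDecomposition R H χ gsp)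
    {E : V → L} (hE : GoodFam R gsp E)
    {α β γ : V} (hα : α ∈ R) (hβ : β ∈ R) (hγ : γ ∈ R) (h : α + β = γ) {z : L} {x y : ℂ}
    (hx : ⁅z, E α⁆ = x • E α) (hy : ⁅z, E β⁆ = y • E β) : ⁅z, E γ⁆ = (x + y) • E γ := by
  obtain ⟨c, hc0, hc⟩ := gf_coef hg hE hα hβ hγ h
  have h1 : ⁅z, ⁅E α, E β⁆⁆ = (x + y) • ⁅E α, E β⁆ := by
    rw [leibniz_lie, hx, hy, smul_lie, lie_smul, add_smul]
  rw [hc, lie_smul, smul_comm] at h1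
  exact smul_right_injective L hc0 h1

theorem gf_A (hR : IsSimplyLacedRootSystem R) (hg : IsRootSpaceDecomposition R H χ gsp)
    {E : V → L} (hE : GoodFam R gsp E)
    {α β : V} (hα : α ∈ R) (hβ : β ∈ R) (h : ⟪α, β⟫ = (-1 : ℝ)) :
    ∃ y : ℂ, y ≠ 0 ∧ ⁅⁅E α, E (-α)⁆, E α⁆ = (-2 * y) • E α ∧ ⁅⁅E α, E (-α)⁆, E β⁆ = y • E β ∧
    ⁅⁅E α, E (-α)⁆, E (α + β)⁆ = (-y) • E (α + β) := by
  have hab := (rt_add_iff hR hα hβ).2 h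
  obtain ⟨y, hy0, hy1, hy2⟩ := gf_A1 hR hg hE hα hβ h
  obtain ⟨y', -, -, hy3⟩ := gf_A1 hR hg hE hα (rt_neg hR hab) (by
    rw [inner_neg_right, inner_add_right, h, hR.norm_two α hα]; norm_num)
  rw [show α + -(α + β) = -β by abel] at hy3
  have h1 := gf_additive hg hE hab (rt_neg hR hβ) hα (by abel) hy2 hy3
  have h2 := gf_additive hg hE hα hβ hab rfl h1 hy1
  rw [hy2] at h2
  have h3 := smul_left_injective ℂ (hE _ hab).2 h2
  try simp only at h3
  refine ⟨y, hy0, ?_, hy1, hy2⟩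
  rw [h1]
  congr 1
  linear_combination -h3

/-- Normalized families. -/
def NormFam (R : Finset V) (E : V → L) : Prop :=
  ∀ α ∈ R, ∀ β ∈ R, ⟪α, β⟫ = (-1 : ℝ) →
    ⁅⁅E α, E (-α)⁆, E α⁆ = (-2 : ℂ) • E α ∧ ⁅⁅E α, E (-α)⁆, E β⁆ = E β

theorem exists_norm (hR : IsSimplyLacedRootSystem R) (hg : IsRootSpaceDecomposition R H χ gsp)
    {E : V → L} (hE : GoodFam R gsp E) (f : V →ₗ[ℝ] ℝ)
    (hf : ∀ β ∈ R, f β ≠ 0) :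
    ∃ E' : V → L, GoodFam R gsp E' ∧ NormFam R E' ∧ ∀ α, 0 < f α → E' α = E α := by
  classical
  have hs : ∀ α : V, ∃ s : ℂ, s ≠ 0 ∧ (α ∈ R → (∃ β ∈ R, ⟪α, β⟫ = (-1 : ℝ)) →
      ⁅⁅E α, s • E (-α)⁆, E α⁆ = (-2 : ℂ) • E α) := by
    intro α
    by_cases h : α ∈ R ∧ ∃ β ∈ R, ⟪α, β⟫ = (-1 : ℝ)
    · obtain ⟨hα, β, hβ, hab⟩ := h
      obtain ⟨y, hy0, hy, -⟩ := gf_A hR hg hE hα hβ hab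
      refine ⟨y⁻¹, inv_ne_zero hy0, fun _ _ => ?_⟩
      rw [lie_smul, smul_lie, hy, smul_smul]
      congr 1
      field_simp
    · exact ⟨1, one_ne_zero, fun h1 h2 => absurd ⟨h1, h2⟩ h⟩
  choose s hs0 hs using hs
  let E' : V → L := fun γ => if f γ < 0 then s (-γ) • E γ else E γ
  have hp : ∀ α, 0 < f α → E' α = E α := fun α h => if_neg (not_lt.2 h.le)
  have hn : ∀ α, 0 < f α → E' (-α) = s α • E (-α) := fun α h => by
    have : f (-α) < 0 := by rw [map_neg]; linarith
    simp only [E', if_pos this, neg_neg]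
  have hE' : GoodFam R gsp E' := by
    intro α hα
    by_cases h : f α < 0
    · simp only [E', if_pos h]
      exact ⟨(gsp α).smul_mem _ (hE α hα).1, smul_ne_zero (hs0 _) (hE α hα).2⟩
    · simp only [E', if_neg h]
      exact hE α hα
  have hpos : ∀ α ∈ R, 0 < f α → ∀ β ∈ R, ⟪α, β⟫ = (-1 : ℝ) →
      ⁅⁅E' α, E' (-α)⁆, E' α⁆ = (-2 : ℂ) • E' α ∧ ⁅⁅E' α, E' (-α)⁆, E' β⁆ = E' β := by
    intro α hα hfα β hβ hab
    obtain ⟨y, hy0, h1, h2, -⟩ := gf_A hR hg hE' hα hβ hab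
    have h3 := hs α hα ⟨β, hβ, hab⟩
    rw [← hn α hfα, ← hp α hfα] at h3
    refine ⟨h3, ?_⟩
    rw [h1] at h3
    have h4 := smul_left_injective ℂ (hE' _ hα).2 h3
    try simp only at h4
    have h5 : y = 1 := by linear_combination (-1/2) * h4
    rw [h2, h5, one_smul]
  refine ⟨E', hE', ?_, hp⟩
  intro α hα β hβ hab
  rcases lt_or_gt_of_ne (hf α hα) with h | h
  · have habR := (rt_add_iff hR hα hβ).2 hab
    obtain ⟨y, hy0, h1, h2, h3⟩ := gf_A hR hg hE' hα hβ hab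
    have h4 := (hpos (-α) (rt_neg hR hα) (by rw [map_neg]; linarith) (α + β) habR (by
      rw [inner_neg_left, inner_add_right, hab, hR.norm_two α hα]; norm_num)).2
    rw [neg_neg, ← lie_skew (E' (-α)) (E' α), neg_lie, h3, neg_smul, neg_neg] at h4
    have h5 : y = 1 := by
      refine smul_left_injective ℂ (hE' _ habR).2 ?_
      try simp only
      rw [h4, one_smul]
    subst h5
    refine ⟨by rw [h1]; norm_num, by rw [h2, one_smul]⟩
  · exact hpos α hα h β hβ hab

theorem pos_core (hR : IsSimplyLacedRootSystem R) (hg : IsRootSpaceDecomposition R H χ gsp)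
    {E : V → L} (hE : GoodFam R gsp E) {ε : V → V → ℂ} (hε : EpsOK R ε) {a d b : V}
    (ha : a ∈ R) (hd : d ∈ R) (hb : b ∈ R) (had : a + d ∈ R) (hdb : d + b ∈ R)
    (hab : ⟪a, b⟫ = (0 : ℝ))
    (h1 : ⁅E a, E d⁆ = ε a d • E (a + d)) (h2 : ⁅E d, E b⁆ = ε d b • E (d + b)) :
    ε (a + d) b • ⁅E (a + d), E b⁆ = ε a (d + b) • ⁅E a, E (d + b)⁆ := by
  have h1' : E (a + d) = ε a d • ⁅E a, E d⁆ := by rw [h1, smul_smul, hε.sq, one_smul]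
  have h2' : E (d + b) = ε d b • ⁅E d, E b⁆ := by rw [h2, smul_smul, hε.sq, one_smul]
  rw [h1', h2', hε.addl a ha d hd b hb had, hε.addr d hd b hb a ha hdb, smul_lie, lie_smul,
    lie_lie, gf_zero hR hg hE ha hb (Or.inl hab), lie_zero, sub_zero, smul_smul, smul_smul]
  congr 1
  ring

theorem swap_core {E : V → L} {ε : V → V → ℂ} (hε : EpsOK R ε) {a b : V}
    (ha : a ∈ R) (hb : b ∈ R) (hab : a + b ∈ R) :
    ε b a • ⁅E b, E a⁆ = ε a b • ⁅E a, E b⁆ := by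
  rw [hε.skew a ha b hb hab, ← lie_skew, smul_neg, neg_smul, neg_neg]

theorem pos_wd (hR : IsSimplyLacedRootSystem R) (hg : IsRootSpaceDecomposition R H χ gsp)
    {E : V → L} (hE : GoodFam R gsp E) {ε : V → V → ℂ} (hε : EpsOK R ε) (f : V →ₗ[ℝ] ℝ)
    (hf : ∀ β ∈ R, 1 ≤ f β ∨ f β ≤ -1) (n : ℝ)
    (hn : ∀ α ∈ R, ∀ β ∈ R, 0 < f α → 0 < f β → α + β ∈ R → f (α + β) ≤ n →
      ⁅E α, E β⁆ = ε α β • E (α + β))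
    {a b a' b' : V} (ha : a ∈ R) (hb : b ∈ R) (ha' : a' ∈ R) (hb' : b' ∈ R)
    (pa : 0 < f a) (pb : 0 < f b) (pa' : 0 < f a') (pb' : 0 < f b') (hab : a + b ∈ R)
    (heq : a + b = a' + b') (hle : f (a + b) ≤ n + 1) :
    ε a b • ⁅E a, E b⁆ = ε a' b' • ⁅E a', E b'⁆ := by
  have one : ∀ x ∈ R, 0 < f x → 1 ≤ f x := fun x hx h => by
    rcases hf x hx with h' | h' <;> linarith

  have core : ∀ a b a' b' : V, a ∈ R → b ∈ R → a' ∈ R → b' ∈ R → 0 < f a → 0 < f b → 0 < f a' →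
      0 < f b' → a + b ∈ R → a + b = a' + b' → f (a + b) ≤ n + 1 → ⟪a, a'⟫ = (1 : ℝ) →
      0 < f (a - a') → ε a b • ⁅E a, E b⁆ = ε a' b' • ⁅E a', E b'⁆ := by
    intro a b a' b' ha hb ha' hb' pa pb pa' pb' hab heq hle hin pd
    have hd := rt_sub hR ha ha' hin
    have e1 : a = a' + (a - a') := by abel
    have e2 : b' = (a - a') + b := by
      have : b' = (a' + b') - a' := by abel
      rw [this, ← heq]; abel
    have had : a' + (a - a') ∈ R := e1 ▸ ha
    have hdb : (a - a') + b ∈ R := e2 ▸ hb'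
    have l1 : f (a' + (a - a')) ≤ n := by
      rw [← e1]; rw [map_add] at hle; linarith [one b hb pb]
    have l2 : f ((a - a') + b) ≤ n := by
      rw [← e2]; rw [heq, map_add] at hle; linarith [one a' ha' pa']
    have hab0 : ⟪a', b⟫ = (0 : ℝ) := by
      have i1 := (rt_add_iff hR ha' hb').1 (heq ▸ hab)
      have : b = b' - (a - a') := by rw [e2]; abel
      rw [this, inner_sub_right, inner_sub_right, i1, real_inner_comm, hin, hR.norm_two a' ha']
      norm_num
    have := pos_core hR hg hE hε ha' hd hb had hdb hab0
      (hn _ ha' _ hd pa' pd had l1) (hn _ hd _ hb pd pb hdb l2)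
    rwa [← e1, ← e2] at this
  have core2 : ∀ a b a' b' : V, a ∈ R → b ∈ R → a' ∈ R → b' ∈ R → 0 < f a → 0 < f b → 0 < f a' →
      0 < f b' → a + b ∈ R → a + b = a' + b' → f (a + b) ≤ n + 1 → ⟪a, a'⟫ = (1 : ℝ) →
      ε a b • ⁅E a, E b⁆ = ε a' b' • ⁅E a', E b'⁆ := by
    intro a b a' b' ha hb ha' hb' pa pb pa' pb' hab heq hle hin
    have hd := rt_sub hR ha ha' hin
    rcases hf _ hd with h | h
    · exact core a b a' b' ha hb ha' hb' pa pb pa' pb' hab heq hle hin (by linarith)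
    · refine (core a' b' a b ha' hb' ha hb pa' pb' pa pb (heq ▸ hab) heq.symm (heq ▸ hle)
        (by rw [real_inner_comm]; exact hin) ?_).symm
      rw [map_sub] at h ⊢
      linarith
  have i1 := (rt_add_iff hR ha hb).1 hab
  have i2 : ⟪a, a'⟫ + ⟪a, b'⟫ = (1 : ℝ) := by
    rw [← inner_add_right, ← heq, inner_add_right, i1, hR.norm_two a ha]; norm_num
  have hab' : a' + b' ∈ R := heq ▸ hab
  have hba' : b' + a' ∈ R := by rwa [add_comm]
  have same : a = a' → ε a b • ⁅E a, E b⁆ = ε a' b' • ⁅E a', E b'⁆ := by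
    rintro rfl
    rw [add_left_cancel heq]
  have same' : a = b' → ε a b • ⁅E a, E b⁆ = ε a' b' • ⁅E a', E b'⁆ := by
    rintro rfl
    rw [add_comm a'] at heq
    rw [add_left_cancel heq]
    exact (swap_core hε ha' ha hab')
  rcases rt_cases hR ha ha' with h | h | h | h | h
  · rw [h, map_neg] at pa; linarith
  · rcases rt_cases hR ha hb' with k | k | k | k | k
    · rw [k, map_neg] at pa; linarith
    · rw [h, k] at i2; norm_num at i2
    · rw [h, k] at i2; norm_num at i2
    · rw [h, k] at i2; norm_num at i2
    · exact same' k
  · rw [← swap_core hε ha' hb' hab']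
    refine core2 a b b' a' ha hb hb' ha' pa pb pb' pa' hab (by rw [heq, add_comm]) hle ?_
    linarith
  · exact core2 a b a' b' ha hb ha' hb' pa pb pa' pb' hab heq hle h
  · exact same h

theorem exists_pos (hR : IsSimplyLacedRootSystem R) (hg : IsRootSpaceDecomposition R H χ gsp)
    {ε : V → V → ℂ} (hε : EpsOK R ε) (f : V →ₗ[ℝ] ℝ)
    (hf : ∀ β ∈ R, ∃ n : ℕ, 0 < n ∧ (f β = n ∨ f β = -n)) (n : ℕ) :
    ∃ E : V → L, GoodFam R gsp E ∧
    (∀ α ∈ R, ∀ β ∈ R, 0 < f α → 0 < f β → α + β ∈ R → f (α + β) ≤ n →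
      ⁅E α, E β⁆ = ε α β • E (α + β)) := by
  classical
  have hf1 : ∀ β ∈ R, 1 ≤ f β ∨ f β ≤ -1 := by
    intro β hβ
    obtain ⟨n, hn, h⟩ := hf β hβ
    have : (1 : ℝ) ≤ n := by exact_mod_cast hn
    rcases h with h | h
    · left; linarith
    · right; linarith
  have one : ∀ x ∈ R, 0 < f x → 1 ≤ f x := fun x hx h => by
    rcases hf1 x hx with h' | h' <;> linarith
  induction n with
  | zero =>
    have : ∀ α : V, ∃ x : L, α ∈ R → x ∈ gsp α ∧ x ≠ 0 := by
      intro α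
      by_cases hα : α ∈ R
      · have : 0 < Module.finrank ℂ (gsp α) := by rw [hg.finrank_eq_one α hα]; norm_num
        have := Module.finrank_pos_iff.1 this
        obtain ⟨x, hx⟩ := exists_ne (0 : gsp α)
        exact ⟨x, fun _ => ⟨x.2, by simpa using hx⟩⟩
      · exact ⟨0, fun h => absurd h hα⟩
    choose E hE using this
    refine ⟨E, hE, ?_⟩
    intro α _ β _ pa pb _ h
    rw [map_add] at h
    push_cast at h
    linarith
  | succ n ih =>
    obtain ⟨E, hE, hn⟩ := ih
    let P : V → V × V → Prop := fun γ p => p.1 ∈ R ∧ p.2 ∈ R ∧ 0 < f p.1 ∧ 0 < f p.2 ∧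
      p.1 + p.2 = γ
    let E' : V → L := fun γ => if h : f γ = n + 1 ∧ ∃ p, P γ p then
      ε h.2.choose.1 h.2.choose.2 • ⁅E h.2.choose.1, E h.2.choose.2⁆ else E γ
    have hlow : ∀ γ, f γ ≤ n → E' γ = E γ := by
      intro γ h
      refine dif_neg ?_
      rintro ⟨h', -⟩
      linarith
    have hεne : ∀ x y, ε x y ≠ 0 := fun x y h => by
      have := hε.sq x y
      rw [h] at this
      norm_num at this
    refine ⟨E', ?_, ?_⟩
    · intro γ hγ
      by_cases h : f γ = n + 1 ∧ ∃ p, P γ p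
      · simp only [E', dif_pos h]
        obtain ⟨h1, h2, h3, h4, h5⟩ := h.2.choose_spec
        have h6 : h.2.choose.1 + h.2.choose.2 ∈ R := by rw [h5]; exact hγ
        constructor
        · refine (gsp γ).smul_mem _ ?_
          have := hg.bracket_mem _ h1 _ h2 h6 _ (hE _ h1).1 _ (hE _ h2).1
          rwa [h5] at this
        · exact smul_ne_zero (hεne _ _)
            (hg.bracket_ne_zero _ h1 _ h2 h6 _ (hE _ h1).1 (hE _ h1).2 _ (hE _ h2).1 (hE _ h2).2)
      · simp only [E', dif_neg h]
        exact hE γ hγ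
    · intro α hα β hβ pa pb hab hle
      have oa := one α hα pa
      have ob := one β hβ pb
      have hle' : f α + f β ≤ n + 1 := by rw [← map_add]; exact_mod_cast hle
      rw [hlow α (by linarith), hlow β (by linarith)]
      by_cases h : f (α + β) ≤ n
      · rw [hlow _ h]
        exact hn α hα β hβ pa pb hab h
      · have hfn : f (α + β) = n + 1 := by
          obtain ⟨k, hk, h1 | h1⟩ := hf _ hab
          · rw [h1] at h hle ⊢
            have h2 : k ≤ n + 1 := by exact_mod_cast hle
            have h3 : ¬ k ≤ n := by exact_mod_cast h
            have : k = n + 1 := by omega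
            rw [this]; push_cast; rfl
          · exfalso
            have : (0 : ℝ) < k := by exact_mod_cast hk
            rw [map_add] at h1
            linarith
        have hex : f (α + β) = n + 1 ∧ ∃ p, P (α + β) p :=
          ⟨hfn, ⟨(α, β), hα, hβ, pa, pb, rfl⟩⟩
        have hE' : E' (α + β) = ε hex.2.choose.1 hex.2.choose.2 •
          ⁅E hex.2.choose.1, E hex.2.choose.2⁆ := dif_pos hex
        obtain ⟨h1, h2, h3, h4, h5⟩ := hex.2.choose_spec
        rw [hE', ← pos_wd hR hg hE hε f hf1 n hn hα hβ h1 h2 pa pb h3 h4 hab h5.symm hfn.le,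
          smul_smul, hε.sq, one_smul]

theorem exists_final (hR : IsSimplyLacedRootSystem R) (hg : IsRootSpaceDecomposition R H χ gsp)
    {ε : V → V → ℂ} (hε : EpsOK R ε) (f : V →ₗ[ℝ] ℝ)
    (hf : ∀ β ∈ R, ∃ n : ℕ, 0 < n ∧ (f β = n ∨ f β = -n)) :
    ∃ E : V → L, GoodFam R gsp E ∧
    (∀ α ∈ R, ∀ β ∈ R, α + β ∈ R → ⁅E α, E β⁆ = ε α β • E (α + β)) := by
  have hf0 : ∀ β ∈ R, f β ≠ 0 := by
    intro β hβ h0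
    obtain ⟨n, hn, h | h⟩ := hf β hβ
    · rw [h0] at h
      have : (0 : ℝ) < n := by exact_mod_cast hn
      linarith
    · rw [h0] at h
      have : (0 : ℝ) < n := by exact_mod_cast hn
      linarith
  obtain ⟨n, hn⟩ : ∃ n : ℕ, ∀ β ∈ R, f β ≤ n := by
    obtain ⟨M, hM⟩ := (R.image f).bddAbove
    obtain ⟨n, hn⟩ := exists_nat_ge M
    exact ⟨n, fun β hβ => (hM (Finset.mem_coe.2 (Finset.mem_image_of_mem f hβ))).trans hn⟩
  obtain ⟨E₀, hE₀, hp₀⟩ := exists_pos hR hg hε f hf n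
  obtain ⟨E, hE, hN, hEE⟩ := exists_norm hR hg hE₀ f hf0
  refine ⟨E, hE, ?_⟩
  have hpos : ∀ α ∈ R, ∀ β ∈ R, 0 < f α → 0 < f β → α + β ∈ R →
      ⁅E α, E β⁆ = ε α β • E (α + β) := by
    intro α hα β hβ pa pb hab
    rw [hEE α pa, hEE β pb, hEE (α + β) (by rw [map_add]; linarith)]
    exact hp₀ α hα β hβ pa pb hab (hn _ hab)
  -- symmetry
  have tsymm : ∀ α ∈ R, ∀ β ∈ R, α + β ∈ R → ⁅E α, E β⁆ = ε α β • E (α + β) →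
      ⁅E β, E α⁆ = ε β α • E (β + α) := by
    intro α hα β hβ hab h
    rw [← lie_skew, h, hε.skew α hα β hβ hab, neg_smul, add_comm]
  -- cyclic symmetry of the coefficients
  have cyc : ∀ α ∈ R, ∀ β ∈ R, α + β ∈ R → ∀ c : ℂ, ⁅E α, E β⁆ = c • E (α + β) →
      ⁅E β, E (-(α + β))⁆ = c • E (-α) := by
    intro α hα β hβ hab c hc
    have hγ := rt_neg hR hab
    have i1 := (rt_add_iff hR hα hβ).1 hab
    have i2 : ⟪β, -(α + β)⟫ = (-1 : ℝ) := by
      rw [inner_neg_right, inner_add_right, real_inner_comm, i1, hR.norm_two β hβ]; norm_num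
    have i3 : ⟪-(α + β), α⟫ = (-1 : ℝ) := by
      rw [inner_neg_left, inner_add_left, real_inner_comm α β, i1, hR.norm_two α hα]; norm_num
    have i1' : ⟪β, α⟫ = (-1 : ℝ) := by rw [real_inner_comm]; exact i1
    have i2' : ⟪-(α + β), β⟫ = (-1 : ℝ) := by rw [real_inner_comm]; exact i2
    have i3' : ⟪α, -(α + β)⟫ = (-1 : ℝ) := by rw [real_inner_comm]; exact i3
    obtain ⟨a, -, ha⟩ := gf_coef hg hE hβ hγ (rt_neg hR hα) (by abel)
    obtain ⟨b, -, hb⟩ := gf_coef hg hE hγ hα (rt_neg hR hβ) (by abel)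
    set γ := -(α + β) with hγdef
    have hc' : ⁅E α, E β⁆ = c • E (-γ) := by rw [hc, hγdef, neg_neg]
    have jac : a • ⁅E α, E (-α)⁆ + b • ⁅E β, E (-β)⁆ + c • ⁅E γ, E (-γ)⁆ = 0 := by
      rw [← lie_smul, ← lie_smul, ← lie_smul, ← ha, ← hb, ← hc']
      exact lie_jacobi _ _ _
    have ja := congrArg (fun z => ⁅z, E α⁆) jac
    have jc := congrArg (fun z => ⁅z, E γ⁆) jac
    simp only [add_lie, smul_lie, zero_lie] at ja jc
    rw [(hN α hα β hβ i1).1, (hN β hβ α hα i1').2, (hN γ hγ α hα i3).2, smul_smul, ← add_smul,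
      ← add_smul] at ja
    rw [(hN α hα γ hγ i3').2, (hN β hβ γ hγ i2).2, (hN γ hγ α hα i3).1, smul_smul, ← add_smul,
      ← add_smul] at jc
    have ja' := (smul_eq_zero.1 ja).resolve_right (hE α hα).2
    have jc' := (smul_eq_zero.1 jc).resolve_right (hE γ hγ).2
    rw [ha]
    congr 1
    linear_combination (-1/3) * ja' + (1/3) * jc'
  have ecyc : ∀ α ∈ R, ∀ β ∈ R, α + β ∈ R → ε β (-(α + β)) = ε α β := by
    intro α hα β hβ hab
    rw [hε.negr β hβ _ hab, hε.addr α hα β hβ β hβ hab, hε.self β hβ, hε.skew α hα β hβ hab]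
    ring
  have tcyc : ∀ α ∈ R, ∀ β ∈ R, α + β ∈ R → ⁅E α, E β⁆ = ε α β • E (α + β) →
      ⁅E β, E (-(α + β))⁆ = ε β (-(α + β)) • E (β + -(α + β)) := by
    intro α hα β hβ hab h
    rw [ecyc α hα β hβ hab, cyc α hα β hβ hab _ h]
    congr 2
    abel
  have tneg : ∀ α ∈ R, ∀ β ∈ R, α + β ∈ R → ⁅E α, E β⁆ = ε α β • E (α + β) →
      ⁅E (-α), E (-β)⁆ = ε (-α) (-β) • E (-α + -β) := by
    intro α hα β hβ hab h
    have i1 := (rt_add_iff hR hα hβ).1 hab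
    obtain ⟨d, -, hd⟩ := gf_coef hg hE hab (rt_neg hR hα) hβ (by abel)
    have h1 := (gf_A0 hR hg hE hα hβ i1 h hd).1
    rw [(hN α hα β hβ i1).2] at h1
    have h2 : ε α β * d = 1 := by
      refine smul_left_injective ℂ (hE _ hβ).2 ?_
      try simp only
      rw [← h1, one_smul]
    have h3 : d = ε α β := by
      have := hε.sq α β
      linear_combination ε α β * h2 - d * this
    have e1 : α + β + -α = β := by abel
    have h4 := cyc (α + β) hab (-α) (rt_neg hR hα) (by rw [e1]; exact hβ) d (by rw [e1]; exact hd)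
    rw [e1] at h4
    rw [h4, h3, hε.negl α hα _ (rt_neg hR hβ), hε.negr α hα β hβ]
    congr 2
    abel
  -- both of the same sign
  have tsame : ∀ α ∈ R, ∀ β ∈ R, (0 < f α ∧ 0 < f β ∨ f α < 0 ∧ f β < 0) → α + β ∈ R →
      ⁅E α, E β⁆ = ε α β • E (α + β) := by
    rintro α hα β hβ (⟨pa, pb⟩ | ⟨pa, pb⟩) hab
    · exact hpos α hα β hβ pa pb hab
    · have hab' : -α + -β ∈ R := by
        rw [← neg_add]; exact rt_neg hR hab
      have := tneg (-α) (rt_neg hR hα) (-β) (rt_neg hR hβ) hab'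
        (hpos _ (rt_neg hR hα) _ (rt_neg hR hβ) (by rw [map_neg]; linarith)
          (by rw [map_neg]; linarith) hab')
      simpa only [neg_neg] using this
  have tmix : ∀ α ∈ R, ∀ β ∈ R, 0 < f α → f β < 0 → α + β ∈ R →
      ⁅E α, E β⁆ = ε α β • E (α + β) := by
    intro α hα β hβ pa pb hab
    have hγ := rt_neg hR hab
    rcases lt_or_gt_of_ne (hf0 _ hab) with h | h
    · have e1 : -(α + β) + α = -β := by abel
      have h1 : -(α + β) + α ∈ R := by rw [e1]; exact rt_neg hR hβ
      have := tcyc _ hγ α hα h1 (tsame _ hγ α hα (Or.inl ⟨by rw [map_neg]; linarith, pa⟩) h1)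
      rwa [e1, neg_neg] at this
    · have e1 : β + -(α + β) = -α := by abel
      have h1 : β + -(α + β) ∈ R := by rw [e1]; exact rt_neg hR hα
      have h2 := tcyc β hβ _ hγ h1 (tsame β hβ _ hγ (Or.inr ⟨pb, by rw [map_neg]; linarith⟩) h1)
      rw [e1, neg_neg] at h2
      have e2 : -(α + β) + α = -β := by abel
      have h3 := tcyc _ hγ α hα (by rw [e2]; exact rt_neg hR hβ) h2
      rwa [e2, neg_neg] at h3
  intro α hα β hβ hab
  rcases lt_or_gt_of_ne (hf0 _ hα) with ha | ha <;> rcases lt_or_gt_of_ne (hf0 _ hβ) with hb | hb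
  · exact tsame α hα β hβ (Or.inr ⟨ha, hb⟩) hab
  · have hba : β + α ∈ R := by rwa [add_comm]
    exact tsymm β hβ α hα hba (tmix β hβ α hα hb ha hba)
  · exact tmix α hα β hβ ha hb hab
  · exact tsame α hα β hβ (Or.inl ⟨ha, hb⟩) hab

end Lie
end Aux

/-- let `C` be a Coxeter element of the Weyl group of the root system `R`
of the simple Lie algebra `L` of type A, D or E.  Then `1 - C` is invertible on `V`, the
form `⟨x, y⟩ = ((1 - C)⁻¹ x, y)` takes integer values on pairs of roots, and there is a
family `(E_α)` of nonzero root vectors `E_α ∈ g_α` such that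
`[E_α, E_β] = (−1)^{⟨α,β⟩} E_{α+β}` whenever `α + β ∈ R`, and `[E_α, E_β] = 0` whenever
`α + β ∉ R` and `α ≠ −β`. -/
theorem coxeter_element_gives_root_basis
    (R : Finset V) (hR : IsSimplyLacedRootSystem R)
    (H : LieSubalgebra ℂ L) (χ : V → H → ℂ) (gsp : V → Submodule ℂ L)
    (hg : IsRootSpaceDecomposition R H χ gsp)
    (C : V →ₗ[ℝ] V) (hC : IsCoxeterElement R C) :
    ∃ D : V →ₗ[ℝ] V, D * ((1 : V →ₗ[ℝ] V) - C) = 1 ∧ ((1 : V →ₗ[ℝ] V) - C) * D = 1 ∧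
      (∀ α ∈ R, ∀ β ∈ R, ∃ n : ℤ, ⟪D α, β⟫ = (n : ℝ)) ∧
      ∃ E : V → L,
        (∀ α ∈ R, E α ∈ gsp α ∧ E α ≠ 0) ∧
        (∀ α ∈ R, ∀ β ∈ R, ∀ n : ℤ, ⟪D α, β⟫ = (n : ℝ) → α + β ∈ R →
          ⁅E α, E β⁆ = ((-1 : ℂ) ^ n) • E (α + β)) ∧
        (∀ α ∈ R, ∀ β ∈ R, α + β ∉ R → α ≠ -β → ⁅E α, E β⁆ = 0) := by
  obtain ⟨⟨f, hf⟩, D, h1, h2, hint, hsum⟩ := cox_main R hR C hC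
  obtain ⟨ε, hε, hεn⟩ := eps_exists R hR D hint hsum
  obtain ⟨E, hE, hbr⟩ := exists_final hR hg hε f hf
  refine ⟨D, h1, h2, hint, E, hE, ?_, ?_⟩
  · intro α hα β hβ n hn hab
    rw [← hεn α hα β hβ n hn]
    exact hbr α hα β hβ hab
  · intro α hα β hβ hab hne
    exact hg.bracket_eq_zero α hα β hβ hab (fun h => hne (eq_neg_of_add_eq_zero_left h)) _
      (hE α hα).1 _ (hE β hβ).1
end

section
/- For every orientation Ω of the Dynkin diagram Γ there exists a reduced word for the longest element w₀ that is adapted to Ω. -/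
variable {I : Type*} [Fintype I] [DecidableEq I]

/-- The Coxeter matrix associated to a simply-laced Dynkin diagram (a simple graph) `G`:
`m i j = 1` if `i = j`, `3` if `i` and `j` are joined by an edge, and `2` otherwise. -/
def coxeterMatrixOfGraph (G : SimpleGraph I) [DecidableRel G.Adj] : CoxeterMatrix I where
  M := Matrix.of fun i j => if i = j then 1 else if G.Adj i j then 3 else 2
  isSymm := by
    unfold Matrix.IsSymm
    ext i j
    by_cases h : i = j
    · simp [h]
    · simp [Matrix.of_apply, h, Ne.symm h, G.adj_comm]
  diagonal := by intro i; simp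
  off_diagonal := by
    intro i j h
    simp only [Matrix.of_apply, if_neg h]
    split <;> omega

/-- An orientation of the graph `G`, encoded as a function assigning to each ordered pair
the value `true` exactly when it is an oriented edge:  every oriented edge is an edge of
`G`, and each edge of `G` is oriented in exactly one of the two directions. -/
def IsOrientation (G : SimpleGraph I) (O : I → I → Bool) : Prop :=
  (∀ i j, O i j = true → G.Adj i j) ∧ (∀ i j, G.Adj i j → O i j = !O j i)

/-- The orientation obtained from `O` by reversing all edges incident to the vertex `i`. -/
def reverseAt (i : I) (O : I → I → Bool) : I → I → Bool :=
  fun j k => if j = i ∨ k = i then O k j else O j k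

/-- `i` is a source of the orientation `O` of `G`: every edge at `i` points away from `i`. -/
def IsSource (G : SimpleGraph I) (O : I → I → Bool) (i : I) : Prop :=
  ∀ j, G.Adj i j → O i j = true

/-- The orientation obtained from `O` by successively reversing at the vertices of `ω`. -/
def orientAfter (O : I → I → Bool) (ω : List I) : I → I → Bool :=
  ω.foldl (fun O' i => reverseAt i O') O

/-- The word `ω = (i₁, …, i_l)` is adapted to the orientation `O`: for each `k`, the
letter `i_k` is a source of the orientation obtained from `O` by successively reversing
at `i₁, …, i_{k-1}`. -/
def IsAdapted (G : SimpleGraph I) (O : I → I → Bool) (ω : List I) : Prop :=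
  ∀ (k : ℕ) (hk : k < ω.length), IsSource G (orientAfter O (ω.take k)) (ω.get ⟨k, hk⟩)

set_option linter.unusedSectionVars false
set_option linter.unusedSimpArgs false

/-- Sum of the coordinates at the neighbours of `i`. -/
def nbSum (G : SimpleGraph I) [DecidableRel G.Adj] (i : I) (v : I → ℤ) : ℤ :=
  ∑ j, if G.Adj i j then v j else 0

lemma nbSum_add (G : SimpleGraph I) [DecidableRel G.Adj] (i : I) (v w : I → ℤ) :
    nbSum G i (v + w) = nbSum G i v + nbSum G i w := by
  simp only [nbSum, ← Finset.sum_add_distrib]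
  refine Finset.sum_congr rfl fun j _ => ?_
  split <;> simp

lemma nbSum_smul (G : SimpleGraph I) [DecidableRel G.Adj] (i : I) (c : ℤ) (v : I → ℤ) :
    nbSum G i (c • v) = c * nbSum G i v := by
  simp only [nbSum, Finset.mul_sum]
  refine Finset.sum_congr rfl fun j _ => ?_
  split <;> simp

lemma nbSum_single (G : SimpleGraph I) [DecidableRel G.Adj] (i k : I) (a : ℤ) :
    nbSum G i (Pi.single k a) = if G.Adj i k then a else 0 := by
  unfold nbSum
  rw [Finset.sum_eq_single k]
  · simp
  · intro b _ hb
    simp [hb]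
  · simp

/-- The simple reflection on the root lattice. -/
def sg (G : SimpleGraph I) [DecidableRel G.Adj] (i : I) : Module.End ℤ (I → ℤ) where
  toFun v := v + Pi.single i (nbSum G i v - 2 * v i)
  map_add' v w := by
    ext k
    by_cases h : k = i
    · subst h
      simp [nbSum_add]; ring
    · simp [h]
  map_smul' c v := by
    ext k
    by_cases h : k = i
    · subst h
      simp only [nbSum_smul, Pi.add_apply, Pi.smul_apply, Pi.single_eq_same, smul_eq_mul,
        RingHom.id_apply]
      ring
    · simp [h]

lemma sg_apply (G : SimpleGraph I) [DecidableRel G.Adj] (i : I) (v : I → ℤ) :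
    sg G i v = v + Pi.single i (nbSum G i v - 2 * v i) := rfl

lemma sg_self (G : SimpleGraph I) [DecidableRel G.Adj] (i : I) (v : I → ℤ) :
    sg G i v i = nbSum G i v - v i := by
  simp [sg_apply]; ring

lemma sg_ne (G : SimpleGraph I) [DecidableRel G.Adj] {i k : I} (h : k ≠ i) (v : I → ℤ) :
    sg G i v k = v k := by
  simp [sg_apply, h]

lemma nbSum_sg (G : SimpleGraph I) [DecidableRel G.Adj] (i k : I) (v : I → ℤ) :
    nbSum G k (sg G i v) = nbSum G k v + if G.Adj k i then nbSum G i v - 2 * v i else 0 := by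
  rw [sg_apply, nbSum_add, nbSum_single]

lemma sg_liftable (G : SimpleGraph I) [DecidableRel G.Adj] :
    (coxeterMatrixOfGraph G).IsLiftable (sg G) := by
  intro i j
  have hM : (coxeterMatrixOfGraph G) i j = if i = j then 1 else if G.Adj i j then 3 else 2 := rfl
  rw [hM]
  by_cases hij : i = j
  · subst hij
    simp only [if_true, pow_one]
    refine LinearMap.ext fun v => ?_
    ext k
    simp only [Module.End.mul_apply, Module.End.one_apply]
    by_cases h : k = i
    · subst h
      simp [sg_self, nbSum_sg]
    · simp [sg_ne, h]
  · have hji : j ≠ i := fun h => hij h.symm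
    by_cases ha : G.Adj i j
    · have ha' := ha.symm
      simp only [hij, ha, if_true, if_false]
      refine LinearMap.ext fun v => ?_
      ext k
      simp only [pow_succ, pow_zero, one_mul, Module.End.mul_apply, Module.End.one_apply]
      by_cases h : k = i
      · subst h
        simp [sg_self, nbSum_sg, sg_ne, hij, hji, ha, ha']
        ring
      · by_cases h' : k = j
        · subst h'
          simp [sg_self, nbSum_sg, sg_ne, hij, hji, ha, ha']
          try ring
        · simp [sg_ne, h, h']
    · have ha' : ¬ G.Adj j i := fun h => ha h.symm
      simp only [hij, ha, if_false]
      refine LinearMap.ext fun v => ?_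
      ext k
      simp only [pow_succ, pow_zero, one_mul, Module.End.mul_apply, Module.End.one_apply]
      by_cases h : k = i
      · subst h
        simp [sg_self, nbSum_sg, sg_ne, hij, hji, ha, ha']
      · by_cases h' : k = j
        · subst h'
          simp [sg_self, nbSum_sg, sg_ne, hij, hji, ha, ha']
        · simp [sg_ne, h, h']

section Rep

variable {G : SimpleGraph I} [DecidableRel G.Adj] {W : Type*} [Group W]
  (cs : CoxeterSystem (coxeterMatrixOfGraph G) W)

/-- The geometric representation (on the root lattice). -/
noncomputable def rp : W →* Module.End ℤ (I → ℤ) := cs.lift ⟨sg G, sg_liftable G⟩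

/-- The simple root. -/
def al (i : I) : I → ℤ := Pi.single i 1

lemma rp_simple (i : I) : rp cs (cs.simple i) = sg G i := cs.lift_apply_simple _ i

lemma rp_mul (u v : W) (x : I → ℤ) : rp cs (u * v) x = rp cs u (rp cs v x) := by
  rw [map_mul]; rfl

lemma rp_one (x : I → ℤ) : rp cs 1 x = x := by
  rw [map_one]; rfl

lemma rp_inv_self (u : W) (x : I → ℤ) : rp cs u⁻¹ (rp cs u x) = x := by
  rw [← rp_mul, inv_mul_cancel, rp_one]

lemma rp_self_inv (u : W) (x : I → ℤ) : rp cs u (rp cs u⁻¹ x) = x := by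
  rw [← rp_mul, mul_inv_cancel, rp_one]

lemma sg_al_self (i : I) : sg G i (al i) = - al i := by
  rw [sg_apply]
  simp only [al, nbSum_single, SimpleGraph.irrefl, if_false]
  ext k
  by_cases h : k = i
  · subst h; simp
  · simp [h]

lemma sg_al_adj {i j : I} (h : G.Adj i j) : sg G i (al j) = al i + al j := by
  rw [sg_apply]
  simp only [al, nbSum_single, h, if_true]
  rw [Pi.single_eq_of_ne h.ne]
  simp [add_comm]

lemma sg_al_nadj {i j : I} (hne : i ≠ j) (h : ¬ G.Adj i j) : sg G i (al j) = al j := by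
  rw [sg_apply]
  simp only [al, nbSum_single, h, if_false]
  rw [Pi.single_eq_of_ne hne]
  simp

lemma al_nonneg (i : I) : 0 ≤ (al i : I → ℤ) := by
  intro k
  by_cases h : k = i
  · subst h; simp [al]
  · simp [al, h]

lemma al_ne (i : I) : (al i : I → ℤ) ≠ 0 := by
  intro h
  have := congrFun h i
  simp [al] at this

lemma simple_comm_of_nadj {i j : I} (hne : i ≠ j) (h : ¬ G.Adj i j) :
    cs.simple i * cs.simple j = cs.simple j * cs.simple i := by
  have h1 := cs.simple_mul_simple_pow i j
  have hM : (coxeterMatrixOfGraph G) i j = if i = j then 1 else if G.Adj i j then 3 else 2 := rfl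
  rw [hM] at h1
  simp only [hne, h, if_false, pow_two] at h1
  have := mul_eq_one_iff_eq_inv.1 h1
  simpa using this

lemma simple_braid_of_adj {i j : I} (h : G.Adj i j) :
    cs.simple i * cs.simple j * cs.simple i = cs.simple j * cs.simple i * cs.simple j := by
  have h1 := cs.simple_mul_simple_pow i j
  have hM : (coxeterMatrixOfGraph G) i j = if i = j then 1 else if G.Adj i j then 3 else 2 := rfl
  rw [hM] at h1
  simp only [h.ne, h, if_false, if_true, pow_succ, pow_zero, one_mul] at h1
  have h2 : cs.simple i * cs.simple j * cs.simple i * (cs.simple j * cs.simple i * cs.simple j) = 1 := by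
    simpa [mul_assoc] using h1
  have := mul_eq_one_iff_eq_inv.1 h2
  simpa [mul_assoc] using this

lemma length_mul_simple_le (w : W) (i : I) : cs.length (w * cs.simple i) ≤ cs.length w + 1 := by
  have := cs.length_mul_le w (cs.simple i)
  simpa using this

lemma root_pos_aux (n : ℕ) : ∀ (w : W) (i : I), cs.length w = n →
    cs.length w < cs.length (w * cs.simple i) → 0 ≤ rp cs w (al i) := by
  induction n using Nat.strong_induction_on with
  | _ n ih =>
  intro w i hn hlt
  by_cases hw : w = 1
  · subst hw
    rw [rp_one]
    exact al_nonneg i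
  obtain ⟨j, hj⟩ := cs.exists_rightDescent_of_ne_one hw
  rw [cs.isRightDescent_iff] at hj
  have hne : j ≠ i := by
    rintro rfl
    omega
  obtain ⟨v, rfl⟩ : ∃ v, w = v * cs.simple j := ⟨w * cs.simple j, by simp⟩
  rw [cs.simple_mul_simple_cancel_right] at hj
  rw [rp_mul, rp_simple]
  by_cases ha : G.Adj j i
  · rw [sg_al_adj ha, map_add]
    have h1 : 0 ≤ rp cs v (al j) := ih _ (by omega) v j rfl (by omega)
    rcases cs.length_mul_simple v i with h2 | h2
    · exact add_nonneg h1 (ih _ (by omega) v i rfl (by omega))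
    · obtain ⟨u, rfl⟩ : ∃ u, v = u * cs.simple i := ⟨v * cs.simple i, by simp⟩
      rw [cs.simple_mul_simple_cancel_right] at h2
      rw [← map_add, rp_mul, rp_simple, add_comm]
      have h3 : sg G i (al i + al j) = al j := by
        rw [map_add, sg_al_self, sg_al_adj ha.symm]; simp
      rw [h3]
      rcases cs.length_mul_simple u j with h4 | h4
      · exact ih _ (by omega) u j rfl (by omega)
      · exfalso
        have e : u * cs.simple i * cs.simple j * cs.simple i =
            u * cs.simple j * cs.simple i * cs.simple j := by
          have := simple_braid_of_adj cs ha
          rw [mul_assoc, mul_assoc, ← mul_assoc (cs.simple i), ← this]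
          simp [mul_assoc]
        rw [e] at hlt
        have := length_mul_simple_le cs (u * cs.simple j * cs.simple i) j
        have := length_mul_simple_le cs (u * cs.simple j) i
        omega
  · rw [sg_al_nadj hne ha]
    rcases cs.length_mul_simple v i with h2 | h2
    · exact ih _ (by omega) v i rfl (by omega)
    · exfalso
      rw [mul_assoc, simple_comm_of_nadj cs hne ha, ← mul_assoc] at hlt
      have := length_mul_simple_le cs (v * cs.simple i) j
      omega

lemma root_pos {w : W} {i : I} (h : cs.length w < cs.length (w * cs.simple i)) :
    0 ≤ rp cs w (al i) := root_pos_aux cs _ w i rfl h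

lemma root_neg {w : W} {i : I} (h : cs.length (w * cs.simple i) < cs.length w) :
    rp cs w (al i) ≤ 0 := by
  have := root_pos cs (w := w * cs.simple i) (i := i) (by simpa using h)
  rw [rp_mul, rp_simple, sg_al_self, map_neg] at this
  exact neg_nonneg.1 this

/-- Being a root. -/
def IsRt (x : I → ℤ) : Prop := ∃ w i, x = rp cs w (al i)

lemma IsRt.sign {x : I → ℤ} (h : IsRt cs x) : 0 ≤ x ∨ x ≤ 0 := by
  obtain ⟨w, i, rfl⟩ := h
  rcases (cs.length_mul_simple_ne w i).lt_or_gt with h | h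
  · exact Or.inr (root_neg cs h)
  · exact Or.inl (root_pos cs h)

lemma IsRt.ne {x : I → ℤ} (h : IsRt cs x) : x ≠ 0 := by
  obtain ⟨w, i, rfl⟩ := h
  intro h0
  apply al_ne i
  rw [← rp_inv_self cs w (al i), h0, map_zero]

lemma IsRt.rp {x : I → ℤ} (h : IsRt cs x) (u : W) : IsRt cs (rp cs u x) := by
  obtain ⟨w, i, rfl⟩ := h
  exact ⟨u * w, i, (rp_mul cs _ _ _).symm⟩

lemma IsRt.sg {x : I → ℤ} (h : IsRt cs x) (i : I) : IsRt cs (sg G i x) := by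
  rw [← rp_simple cs]
  exact h.rp cs _

lemma IsRt.neg {x : I → ℤ} (h : IsRt cs x) : IsRt cs (-x) := by
  obtain ⟨w, i, rfl⟩ := h
  refine ⟨w * cs.simple i, i, ?_⟩
  rw [rp_mul, rp_simple, sg_al_self, map_neg]

lemma not_nonneg_nonpos {x : I → ℤ} (h : IsRt cs x) (h1 : 0 ≤ x) (h2 : x ≤ 0) : False :=
  h.ne cs (le_antisymm h2 h1)

/-- A nonnegative vector made nonpositive by `s_i` is a multiple of `α_i`. -/
lemma eq_smul_of_sg_nonpos {x : I → ℤ} {i : I} (h1 : 0 ≤ x) (h2 : sg G i x ≤ 0) :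
    x = (x i) • al i := by
  ext k
  by_cases h : k = i
  · subst h; simp [al]
  · have a := h1 k
    have b := h2 k
    rw [sg_ne G h] at b
    simp only [Pi.zero_apply] at a b
    simp [al, h]
    omega

lemma eq_longest_of_all_desc {w w₀ : W} (hw₀ : ∀ w : W, cs.length w ≤ cs.length w₀)
    (h : ∀ i, rp cs w (al i) ≤ 0) : w = w₀ := by
  by_contra hne
  have hne' : w₀⁻¹ * w ≠ 1 := by
    intro h'
    exact hne (inv_mul_eq_one.1 h').symm
  obtain ⟨i, hi⟩ := cs.exists_rightDescent_of_ne_one hne'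
  have h1 := root_neg cs hi
  have h0 : ∀ j, rp cs w₀ (al j) ≤ 0 := fun j => root_neg cs
    (lt_of_le_of_ne (hw₀ _) (cs.length_mul_simple_ne w₀ j))
  -- nonneg vectors are mapped to nonpos vectors
  have key : ∀ x : I → ℤ, 0 ≤ x → rp cs w₀ x ≤ 0 := by
    intro x hx
    have : x = ∑ j, x j • (al j : I → ℤ) := by
      ext k
      simp [al, Finset.sum_apply, Pi.single_apply]
    rw [this, map_sum]
    refine Finset.sum_nonpos fun j _ => ?_
    rw [map_smul]
    exact smul_nonpos_of_nonneg_of_nonpos (hx j) (h0 j)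
  have h2 := key (-(rp cs (w₀⁻¹ * w) (al i))) (neg_nonneg.2 h1)
  rw [map_neg, ← rp_mul, mul_inv_cancel_left, neg_nonpos] at h2
  exact not_nonneg_nonpos cs ⟨w, i, rfl⟩ h2 (h i)

end Rep

lemma sg_eq_smul (G : SimpleGraph I) [DecidableRel G.Adj] (i : I) (v : I → ℤ) :
    sg G i v = v + (nbSum G i v - 2 * v i) • al i := by
  rw [sg_apply]
  congr 1
  ext k
  by_cases h : k = i
  · subst h; simp [al]
  · simp [al, h]

/-- The Euler form of an orientation. -/
def eu (O : I → I → Bool) (x y : I → ℤ) : ℤ :=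
  ∑ k, x k * y k - ∑ k, ∑ l, if O k l = true then x k * y l else 0

lemma eu_add_smul_left (O : I → I → Bool) (x z y : I → ℤ) (a : ℤ) :
    eu O (x + a • z) y = eu O x y + a * eu O z y := by
  have h1 : ∑ k, (x + a • z) k * y k = ∑ k, x k * y k + a * ∑ k, z k * y k := by
    rw [Finset.mul_sum, ← Finset.sum_add_distrib]
    refine Finset.sum_congr rfl fun k _ => ?_
    simp only [Pi.add_apply, Pi.smul_apply, smul_eq_mul]; ring
  have h2 : (∑ k, ∑ l, if O k l = true then (x + a • z) k * y l else 0) =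
      (∑ k, ∑ l, if O k l = true then x k * y l else 0) +
      a * ∑ k, ∑ l, if O k l = true then z k * y l else 0 := by
    simp only [Finset.mul_sum, ← Finset.sum_add_distrib]
    refine Finset.sum_congr rfl fun k _ => Finset.sum_congr rfl fun l _ => ?_
    split
    · simp only [Pi.add_apply, Pi.smul_apply, smul_eq_mul]; ring
    · simp
  unfold eu
  rw [h1, h2]; ring

lemma eu_add_smul_right (O : I → I → Bool) (x z y : I → ℤ) (a : ℤ) :
    eu O y (x + a • z) = eu O y x + a * eu O y z := by
  have h1 : ∑ k, y k * (x + a • z) k = ∑ k, y k * x k + a * ∑ k, y k * z k := by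
    rw [Finset.mul_sum, ← Finset.sum_add_distrib]
    refine Finset.sum_congr rfl fun k _ => ?_
    simp only [Pi.add_apply, Pi.smul_apply, smul_eq_mul]; ring
  have h2 : (∑ k, ∑ l, if O k l = true then y k * (x + a • z) l else 0) =
      (∑ k, ∑ l, if O k l = true then y k * x l else 0) +
      a * ∑ k, ∑ l, if O k l = true then y k * z l else 0 := by
    simp only [Finset.mul_sum, ← Finset.sum_add_distrib]
    refine Finset.sum_congr rfl fun k _ => Finset.sum_congr rfl fun l _ => ?_
    split
    · simp only [Pi.add_apply, Pi.smul_apply, smul_eq_mul]; ring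
    · simp
  unfold eu
  rw [h1, h2]; ring

lemma eu_smul_left (O : I → I → Bool) (z y : I → ℤ) (a : ℤ) :
    eu O (a • z) y = a * eu O z y := by
  have := eu_add_smul_left O 0 z y a
  have h0 : eu O 0 y = 0 := by simp [eu]
  rwa [h0, zero_add, zero_add] at this

lemma eu_al_left (O : I → I → Bool) (i : I) (y : I → ℤ) :
    eu O (al i) y = y i - ∑ l, if O i l = true then y l else 0 := by
  unfold eu
  congr 1
  · rw [Finset.sum_eq_single i]
    · simp [al]
    · intro k _ hk; simp [al, hk]
    · simp
  · rw [Finset.sum_eq_single i]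
    · simp [al]
    · intro k _ hk; simp [al, hk]
    · simp

lemma eu_al_right (O : I → I → Bool) (i : I) (x : I → ℤ) :
    eu O x (al i) = x i - ∑ k, if O k i = true then x k else 0 := by
  unfold eu
  congr 1
  · rw [Finset.sum_eq_single i]
    · simp [al]
    · intro k _ hk; simp [al, hk]
    · simp
  · refine Finset.sum_congr rfl fun k _ => ?_
    rw [Finset.sum_eq_single i]
    · simp [al]
    · intro k _ hk; simp [al, hk]
    · simp

section Orient

variable {G : SimpleGraph I} [DecidableRel G.Adj] {O : I → I → Bool}

lemma IsOrientation.reverseAt (hO : IsOrientation G O) (i : I) :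
    IsOrientation G (reverseAt i O) := by
  constructor
  · intro j k h
    unfold _root_.reverseAt at h
    split at h
    · exact (hO.1 _ _ h).symm
    · exact hO.1 _ _ h
  · intro j k h
    unfold _root_.reverseAt
    by_cases hh : j = i ∨ k = i
    · have hh' : k = i ∨ j = i := hh.symm
      simp only [hh, hh', if_true]
      exact hO.2 _ _ h.symm
    · have hh' : ¬ (k = i ∨ j = i) := fun x => hh x.symm
      simp only [hh, hh', if_false]
      exact hO.2 _ _ h

lemma source_iff (hO : IsOrientation G O) {i : I} (hi : IsSource G O i) (l : I) :
    O i l = true ↔ G.Adj i l := ⟨hO.1 _ _, hi l⟩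

lemma source_in (hO : IsOrientation G O) {i : I} (hi : IsSource G O i) (l : I) :
    O l i = false := by
  by_contra h
  have h1 : O l i = true := by simpa using h
  have h2 := hO.1 _ _ h1
  have h3 := hO.2 _ _ h2
  rw [h1, hi l h2.symm] at h3
  simp at h3

lemma eu_source_left (hO : IsOrientation G O) {i : I} (hi : IsSource G O i) (y : I → ℤ) :
    eu O (al i) y = y i - nbSum G i y := by
  rw [eu_al_left]
  simp only [source_iff hO hi, nbSum]

lemma eu_rev (hO : IsOrientation G O) {i : I} (hi : IsSource G O i) (x y : I → ℤ) :
    eu (reverseAt i O) x y = eu O x y + x i * nbSum G i y - y i * nbSum G i x := by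
  have h : (∑ k, ∑ l, if reverseAt i O k l = true then x k * y l else 0) =
      (∑ k, ∑ l, if O k l = true then x k * y l else 0) +
      (∑ k, ∑ l, if l = i then (if G.Adj i k then x k * y l else 0) else 0) -
      (∑ k, ∑ l, if k = i then (if G.Adj i l then x k * y l else 0) else 0) := by
    simp only [← Finset.sum_add_distrib, ← Finset.sum_sub_distrib]
    refine Finset.sum_congr rfl fun k _ => Finset.sum_congr rfl fun l _ => ?_
    unfold reverseAt
    by_cases hk : k = i
    · subst hk
      by_cases hl : l = k
      · subst hl
        simp
      · simp [hl, source_in hO hi, source_iff hO hi]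
    · by_cases hl : l = i
      · subst hl
        simp [hk, source_in hO hi, source_iff hO hi]
      · simp [hk, hl]
  have e1 : (∑ k, ∑ l, if l = i then (if G.Adj i k then x k * y l else 0) else 0) =
      y i * nbSum G i x := by
    simp only [Finset.sum_ite_eq', Finset.mem_univ, if_true, nbSum, Finset.mul_sum]
    refine Finset.sum_congr rfl fun k _ => ?_
    split
    · ring
    · simp
  have e2 : (∑ k, ∑ l, if k = i then (if G.Adj i l then x k * y l else 0) else 0) =
      x i * nbSum G i y := by
    rw [Finset.sum_comm]
    simp only [Finset.sum_ite_eq', Finset.mem_univ, if_true, nbSum, Finset.mul_sum]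
    refine Finset.sum_congr rfl fun k _ => ?_
    split
    · ring
    · simp
  unfold eu
  rw [h, e1, e2]; ring

lemma eu_sg (hO : IsOrientation G O) {i : I} (hi : IsSource G O i) (x y : I → ℤ) :
    eu (reverseAt i O) (sg G i x) (sg G i y) = eu O x y := by
  have hR : ∀ z, eu O z (al i) = z i := by
    intro z
    rw [eu_al_right]
    simp [source_in hO hi]
  rw [eu_rev hO hi, sg_self, sg_self, nbSum_sg, nbSum_sg, sg_eq_smul, sg_eq_smul,
    eu_add_smul_left, eu_add_smul_right, eu_add_smul_right, hR, hR, eu_source_left hO hi]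
  simp [al]
  ring

lemma IsOrientation.orientAfter (ω : List I) : ∀ {O : I → I → Bool}, IsOrientation G O →
    IsOrientation G (orientAfter O ω) := by
  induction ω with
  | nil => intro O h; exact h
  | cons i ω ih => intro O h; exact ih (h.reverseAt i)

lemma adapted_head {i : I} {ω : List I} (h : IsAdapted G O (i :: ω)) : IsSource G O i :=
  h 0 (by simp)

lemma adapted_tail {i : I} {ω : List I} (h : IsAdapted G O (i :: ω)) :
    IsAdapted G (reverseAt i O) ω := by
  intro k hk
  exact h (k + 1) (by simpa using hk)

lemma adapted_append {i : I} {ω : List I} (h : IsAdapted G O ω)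
    (hi : IsSource G (orientAfter O ω) i) : IsAdapted G O (ω ++ [i]) := by
  intro k hk
  by_cases hk' : k < ω.length
  · have := h k hk'
    rw [List.take_append_of_le_length hk'.le]
    simpa [List.getElem_append_left hk'] using this
  · have : k = ω.length := by simp at hk; omega
    subst this
    simpa using hi

variable {W : Type*} [Group W] (cs : CoxeterSystem (coxeterMatrixOfGraph G) W)

lemma eu_word (ω : List I) : ∀ {O : I → I → Bool}, IsOrientation G O → IsAdapted G O ω →
    ∀ x y, eu (orientAfter O ω) x y = eu O (rp cs (cs.wordProd ω) x) (rp cs (cs.wordProd ω) y) := by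
  induction ω with
  | nil =>
    intro O _ _ x y
    rw [cs.wordProd_nil, rp_one, rp_one]
    rfl
  | cons i ω ih =>
    intro O hO h x y
    have h1 := ih (hO.reverseAt i) (adapted_tail h) x y
    have hi := adapted_head h
    rw [cs.wordProd_cons, rp_mul, rp_mul, rp_simple]
    have hinv : ∀ z, sg G i (sg G i z) = z := by
      intro z
      rw [← rp_simple cs, ← rp_mul, cs.simple_mul_simple_self, rp_one]
    rw [← eu_sg hO hi, hinv, hinv, ← h1]
    rfl

lemma inv_lemma (ω : List I) : ∀ {O : I → I → Bool}, IsOrientation G O → IsAdapted G O ω →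
    cs.IsReduced ω → ∀ x y, IsRt cs x → IsRt cs y → 0 ≤ x → 0 ≤ y →
    rp cs (cs.wordProd ω)⁻¹ x ≤ 0 → 0 ≤ rp cs (cs.wordProd ω)⁻¹ y → eu O x y ≤ 0 := by
  induction ω with
  | nil =>
    intro O _ _ _ x y hx hy hx0 hy0 h1 h2
    rw [cs.wordProd_nil, inv_one, rp_one] at h1
    exact (not_nonneg_nonpos cs hx hx0 h1).elim
  | cons i ω ih =>
    intro O hO h hred x y hx hy hx0 hy0 h1 h2
    have hi := adapted_head h
    have htail : cs.IsReduced ω := by simpa using hred.drop 1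
    have hneg : rp cs (cs.wordProd (i :: ω))⁻¹ (al i) ≤ 0 := by
      apply root_neg
      rw [cs.wordProd_cons, mul_inv_rev, cs.inv_simple, cs.simple_mul_simple_cancel_right,
        cs.length_inv]
      have a := htail.eq
      have b := hred.eq
      rw [cs.wordProd_cons] at b
      rw [← cs.length_inv (cs.simple i * _), mul_inv_rev, cs.inv_simple] at b
      rw [a, b]
      simp
    have hsy : 0 ≤ sg G i y := by
      rcases (hy.sg cs i).sign with h' | h'
      · exact h'
      · exfalso
        have e := eq_smul_of_sg_nonpos hy0 h'
        apply not_nonneg_nonpos cs (hy.rp cs _) h2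
        rw [e, map_smul]
        exact smul_nonpos_of_nonneg_of_nonpos (hy0 i) hneg
    rcases (hx.sg cs i).sign with h' | h'
    · rw [← eu_sg hO hi]
      have e : ∀ z, rp cs (cs.wordProd ω)⁻¹ (sg G i z) = rp cs (cs.wordProd (i :: ω))⁻¹ z := by
        intro z
        rw [cs.wordProd_cons, mul_inv_rev, cs.inv_simple, rp_mul, rp_simple]
      refine ih (hO.reverseAt i) (adapted_tail h) htail _ _ (hx.sg cs i) (hy.sg cs i) h' hsy ?_ ?_
      · rw [e]; exact h1
      · rw [e]; exact h2
    · have e := eq_smul_of_sg_nonpos hx0 h'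
      rw [e, eu_smul_left, eu_source_left hO hi]
      have := hsy i
      rw [sg_self] at this
      have h3 : y i - nbSum G i y ≤ 0 := by
        simp only [Pi.zero_apply] at this
        omega
      exact mul_nonpos_of_nonneg_of_nonpos (hx0 i) h3

lemma no_arrow (hO : IsOrientation G O) {ω : List I} (h : IsAdapted G O ω)
    (hred : cs.IsReduced ω) {i j : I} (hi : rp cs (cs.wordProd ω) (al i) ≤ 0)
    (hj : 0 ≤ rp cs (cs.wordProd ω) (al j)) : orientAfter O ω i j = false := by
  by_contra hc
  have hc : orientAfter O ω i j = true := by simpa using hc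
  have hij : i ≠ j := ((hO.orientAfter ω).1 _ _ hc).ne
  have h1 := inv_lemma cs ω hO h hred (-(rp cs (cs.wordProd ω) (al i)))
    (rp cs (cs.wordProd ω) (al j)) (IsRt.neg cs ⟨_, _, rfl⟩) ⟨_, _, rfl⟩ (neg_nonneg.2 hi) hj
    (by rw [map_neg, rp_inv_self]; exact neg_nonpos.2 (al_nonneg i))
    (by rw [rp_inv_self]; exact al_nonneg j)
  rw [← neg_one_smul ℤ, eu_smul_left, ← eu_word cs ω hO h, eu_al_left] at h1
  have h2 : (∑ l, if orientAfter O ω i l = true then (al j : I → ℤ) l else 0) = 1 := by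
    rw [Finset.sum_eq_single j]
    · simp [al, hc]
    · intro l _ hl; simp [al, hl]
    · simp
  rw [h2] at h1
  simp [al, hij] at h1

end Orient

section Finite

variable {G : SimpleGraph I} [DecidableRel G.Adj] {W : Type*} [Group W] [Fintype W]
  (cs : CoxeterSystem (coxeterMatrixOfGraph G) W)

/-- The averaged inner product. -/
noncomputable def fm (x y : I → ℤ) : ℤ := ∑ w : W, ∑ k, rp cs w x k * rp cs w y k

lemma fm_add_right (x y z : I → ℤ) : fm cs x (y + z) = fm cs x y + fm cs x z := by
  simp only [fm, map_add, Pi.add_apply, mul_add, Finset.sum_add_distrib]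

lemma fm_smul_right (x y : I → ℤ) (a : ℤ) : fm cs x (a • y) = a * fm cs x y := by
  simp only [fm, map_smul, Pi.smul_apply, smul_eq_mul, Finset.mul_sum]
  refine Finset.sum_congr rfl fun k _ => Finset.sum_congr rfl fun l _ => ?_
  ring

lemma fm_comm (x y : I → ℤ) : fm cs x y = fm cs y x := by
  simp only [fm, mul_comm]

lemma fm_sum_left (S : Finset I) (f : I → I → ℤ) (y : I → ℤ) :
    fm cs (∑ i ∈ S, f i) y = ∑ i ∈ S, fm cs (f i) y := by
  classical
  induction S using Finset.induction_on with
  | empty => simp [fm]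
  | insert a s ha ih =>
    rw [Finset.sum_insert ha, Finset.sum_insert ha, fm_comm, fm_add_right, fm_comm,
      fm_comm cs y, ih]

lemma fm_inv (u : W) (x y : I → ℤ) : fm cs (rp cs u x) (rp cs u y) = fm cs x y := by
  unfold fm
  simp only [← rp_mul]
  exact Equiv.sum_comp (Equiv.mulRight u) (fun w => ∑ k, rp cs w x k * rp cs w y k)

lemma fm_nonneg (x : I → ℤ) : 0 ≤ fm cs x x :=
  Finset.sum_nonneg fun _ _ => Finset.sum_nonneg fun _ _ => mul_self_nonneg _

lemma fm_pos (x : I → ℤ) (hx : x ≠ 0) : 0 < fm cs x x := by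
  obtain ⟨k, hk⟩ := Function.ne_iff.1 hx
  refine Finset.sum_pos' (fun _ _ => Finset.sum_nonneg fun _ _ => mul_self_nonneg _)
    ⟨1, Finset.mem_univ _, ?_⟩
  refine Finset.sum_pos' (fun _ _ => mul_self_nonneg _) ⟨k, Finset.mem_univ _, ?_⟩
  rw [rp_one]
  exact mul_self_pos.2 hk

lemma fm_al (i : I) (y : I → ℤ) :
    2 * fm cs (al i) y = (2 * y i - nbSum G i y) * fm cs (al i) (al i) := by
  have h := fm_inv cs (cs.simple i) (al i) y
  rw [rp_simple, sg_al_self, sg_eq_smul, ← neg_one_smul ℤ, fm_comm, fm_smul_right, fm_comm,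
    fm_add_right, fm_smul_right] at h
  linarith

lemma no_two_nbrs (cs : CoxeterSystem (coxeterMatrixOfGraph G) W) (S : Finset I) (hS : S.Nonempty)
    (h : ∀ i ∈ S, ∃ a ∈ S, ∃ b ∈ S, a ≠ b ∧ G.Adj i a ∧ G.Adj i b) : False := by
  have hxc : ∀ j, (∑ i ∈ S, (al i : I → ℤ)) j = if j ∈ S then 1 else 0 := by
    intro j
    simp [al, Finset.sum_apply, Pi.single_apply]
  obtain ⟨x, hx⟩ : ∃ x : I → ℤ, x = ∑ i ∈ S, (al i : I → ℤ) := ⟨_, rfl⟩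
  rw [← hx] at hxc
  have hne : x ≠ 0 := by
    obtain ⟨i, hi⟩ := hS
    intro h0
    have := hxc i
    simp [h0, hi] at this
  have hp := fm_pos cs x hne
  have hle : 2 * fm cs x x ≤ 0 := by
    have e : fm cs x x = ∑ i ∈ S, fm cs (al i) x := by
      conv_lhs => rw [hx, fm_sum_left, ← hx]
    rw [e, Finset.mul_sum]
    refine Finset.sum_nonpos fun i hi => ?_
    rw [fm_al]
    refine mul_nonpos_of_nonpos_of_nonneg ?_ (fm_nonneg cs _)
    obtain ⟨a, ha, b, hb, hab, hia, hib⟩ := h i hi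
    have h2 : (2 : ℤ) ≤ nbSum G i x := by
      unfold nbSum
      have hsub : ∑ j ∈ ({a, b} : Finset I), (if G.Adj i j then x j else 0) ≤
          ∑ j, (if G.Adj i j then x j else 0) := by
        refine Finset.sum_le_sum_of_subset_of_nonneg (Finset.subset_univ _) fun j _ _ => ?_
        rw [hxc]
        split <;> [split <;> simp; simp]
      rw [Finset.sum_pair hab] at hsub
      simp only [hia, hib, hxc, ha, hb, if_true] at hsub
      simpa [hxc] using hsub
    rw [hxc, if_pos hi]
    omega
  omega

lemma no_pred_closed (cs : CoxeterSystem (coxeterMatrixOfGraph G) W) 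
    {O : I → I → Bool} (hO : IsOrientation G O) (n : ℕ) : ∀ (S : Finset I),
    S.card = n → S.Nonempty → (∀ i ∈ S, ∃ a ∈ S, O a i = true) → False := by
  induction n with
  | zero =>
    intro S hc hS _
    simp only [Finset.card_eq_zero] at hc
    subst hc
    simp at hS
  | succ n ih =>
    intro S hc hS h
    by_cases hs : ∀ i ∈ S, ∃ b ∈ S, O i b = true
    · refine no_two_nbrs cs S hS fun i hi => ?_
      obtain ⟨a, ha, hai⟩ := h i hi
      obtain ⟨b, hb, hib⟩ := hs i hi
      refine ⟨a, ha, b, hb, ?_, (hO.1 _ _ hai).symm, hO.1 _ _ hib⟩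
      rintro rfl
      have := hO.2 _ _ (hO.1 _ _ hai)
      rw [hai, hib] at this
      simp at this
    · push Not at hs
      obtain ⟨v, hv, hvb⟩ := hs
      refine ih (S.erase v) (by rw [Finset.card_erase_of_mem hv]; omega) ?_ ?_
      · obtain ⟨a, ha, hav⟩ := h v hv
        exact ⟨a, Finset.mem_erase.2 ⟨(hO.1 _ _ hav).ne, ha⟩⟩
      · intro i hi
        have hi' := Finset.mem_erase.1 hi
        obtain ⟨a, ha, hai⟩ := h i hi'.2
        refine ⟨a, Finset.mem_erase.2 ⟨?_, ha⟩, hai⟩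
        rintro rfl
        exact hvb i hi'.2 hai

lemma extend_word {O : I → I → Bool} (hO : IsOrientation G O) {w₀ : W}
    (hw₀ : ∀ w : W, cs.length w ≤ cs.length w₀) {ω : List I} (h : IsAdapted G O ω)
    (hred : cs.IsReduced ω) (hne : cs.wordProd ω ≠ w₀) :
    ∃ i, IsAdapted G O (ω ++ [i]) ∧ cs.IsReduced (ω ++ [i]) := by
  classical
  by_contra hcon
  push Not at hcon
  have hsrc : ∀ i, IsSource G (orientAfter O ω) i → rp cs (cs.wordProd ω) (al i) ≤ 0 := by
    intro i hi
    have h1 := hcon i (adapted_append h hi)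
    rcases cs.length_mul_simple (cs.wordProd ω) i with h2 | h2
    · exfalso
      apply h1
      unfold CoxeterSystem.IsReduced
      rw [cs.wordProd_append, cs.wordProd_singleton, h2, hred.eq]
      simp
    · exact root_neg cs (by omega)
  have hO' := hO.orientAfter (G := G) ω
  refine no_pred_closed cs hO' _
    (Finset.univ.filter fun j => 0 ≤ rp cs (cs.wordProd ω) (al j)) rfl ?_ ?_
  · by_contra hemp
    rw [Finset.not_nonempty_iff_eq_empty, Finset.filter_eq_empty_iff] at hemp
    apply hne
    apply eq_longest_of_all_desc cs hw₀
    intro i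
    rcases IsRt.sign cs ⟨cs.wordProd ω, i, rfl⟩ with h' | h'
    · exact (hemp (Finset.mem_univ i) h').elim
    · exact h'
  · intro j hj
    have hj := (Finset.mem_filter.1 hj).2
    have hns : ¬ IsSource G (orientAfter O ω) j := fun hs =>
      not_nonneg_nonpos cs ⟨_, _, rfl⟩ hj (hsrc j hs)
    unfold IsSource at hns
    push Not at hns
    obtain ⟨a, haj, hf⟩ := hns
    have haO : orientAfter O ω a j = true := by
      rw [hO'.2 _ _ haj.symm]
      simpa using hf
    refine ⟨a, Finset.mem_filter.2 ⟨Finset.mem_univ _, ?_⟩, haO⟩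
    rcases IsRt.sign cs ⟨cs.wordProd ω, a, rfl⟩ with h' | h'
    · exact h'
    · have := no_arrow cs hO h hred h' hj
      rw [haO] at this
      simp at this

end Finite

/-- for every orientation `Ω` of a simply-laced Dynkin diagram `Γ` (a
connected simple graph whose associated Coxeter group `W` is finite, i.e. type A, D or E),
there exists a reduced word for the longest element `w₀` of `W` that is adapted to `Ω`. -/
theorem exists_adapted_reduced_word_for_longest_element
    (G : SimpleGraph I) [DecidableRel G.Adj] (hconn : G.Connected)
    {W : Type*} [Group W] [Finite W]
    (cs : CoxeterSystem (coxeterMatrixOfGraph G) W)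
    (w₀ : W) (hw₀ : ∀ w : W, cs.length w ≤ cs.length w₀)
    (O : I → I → Bool) (hO : IsOrientation G O) :
    ∃ ω : List I, cs.wordProd ω = w₀ ∧ cs.IsReduced ω ∧ IsAdapted G O ω := by
  classical
  haveI : Fintype W := Fintype.ofFinite W
  by_contra hcon
  push Not at hcon
  have key : ∀ n : ℕ, ∃ ω : List I, ω.length = n ∧ cs.IsReduced ω ∧ IsAdapted G O ω := by
    intro n
    induction n with
    | zero =>
      refine ⟨[], rfl, by simp [CoxeterSystem.IsReduced], ?_⟩
      intro k hk
      simp at hk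
    | succ n ih =>
      obtain ⟨ω, hl, hred, had⟩ := ih
      have hne : cs.wordProd ω ≠ w₀ := fun e => hcon ω e hred had
      obtain ⟨i, h1, h2⟩ := extend_word cs hO hw₀ had hred hne
      exact ⟨ω ++ [i], by simp [hl], h2, h1⟩
  obtain ⟨ω, hl, hred, _⟩ := key (cs.length w₀ + 1)
  have := hw₀ (cs.wordProd ω)
  rw [hred.eq, hl] at this
  omega
end

section
/- Any two reduced words for the longest element w₀ that are adapted to the same orientation Ω of Γ can be obtained from one another by a finite sequence of moves each of which exchanges two adjacent letters i_k, i_{k+1} such that i_k and i_{k+1} are not joined by an edge of Γ (i.e., using only the commutation relations s_i s_j = s_j s_i for non-adjacent i, j). -/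
variable {I : Type*} [Fintype I] [DecidableEq I]

/-- A single commutation move on words: exchange two adjacent letters `i, j` that are
not joined by an edge of `G` (i.e. use the braid relation `s_i s_j = s_j s_i`). -/
def CommMove (G : SimpleGraph I) (ω ω' : List I) : Prop :=
  ∃ (l₁ l₂ : List I) (i j : I), ¬ G.Adj i j ∧
    ω = l₁ ++ i :: j :: l₂ ∧ ω' = l₁ ++ j :: i :: l₂


section AdaptedHelpers

theorem cmg_apply (G : SimpleGraph I) [DecidableRel G.Adj] (i j : I) :
    (coxeterMatrixOfGraph G) i j = if i = j then 1 else if G.Adj i j then 3 else 2 := rfl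

theorem isAdapted_cons (G : SimpleGraph I) (O : I → I → Bool) (i : I) (ω : List I) :
    IsAdapted G O (i :: ω) ↔ IsSource G O i ∧ IsAdapted G (reverseAt i O) ω := by
  constructor
  · intro h
    refine ⟨h 0 (by simp), fun k hk => ?_⟩
    exact h (k + 1) (by simpa using hk)
  · rintro ⟨h0, h⟩ k hk
    cases k with
    | zero => exact h0
    | succ k => exact h k (by simpa using hk)

theorem isOrientation_reverseAt {G : SimpleGraph I} {O : I → I → Bool}
    (h : IsOrientation G O) (i : I) : IsOrientation G (reverseAt i O) := by
  obtain ⟨h1, h2⟩ := h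
  refine ⟨fun a b hab => ?_, fun a b hab => ?_⟩
  · unfold reverseAt at hab
    split_ifs at hab
    · exact (h1 _ _ hab).symm
    · exact h1 _ _ hab
  · unfold reverseAt
    by_cases hc : a = i ∨ b = i
    · rw [if_pos hc, if_pos hc.symm, h2 b a hab.symm]
    · rw [if_neg hc, if_neg (fun h => hc h.symm), h2 a b hab]

theorem not_adj_of_sources {G : SimpleGraph I} {O : I → I → Bool}
    (h : IsOrientation G O) {i j : I} (hi : IsSource G O i) (hj : IsSource G O j) :
    ¬ G.Adj i j := by
  intro hadj
  have h1 := hi j hadj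
  have h2 := hj i hadj.symm
  have h3 := h.2 i j hadj
  simp [h1, h2] at h3

theorem isSource_reverseAt {G : SimpleGraph I} {O : I → I → Bool}
    {i j : I} (hij : i ≠ j) (hadj : ¬ G.Adj i j) (hi : IsSource G O i) :
    IsSource G (reverseAt j O) i := by
  intro k hk
  have : k ≠ j := fun h => hadj (h ▸ hk)
  simp [reverseAt, hij, this, hi k hk]

theorem reverseAt_comm {i j : I} (hij : i ≠ j) (O : I → I → Bool) :
    reverseAt i (reverseAt j O) = reverseAt j (reverseAt i O) := by
  funext a b
  unfold reverseAt
  grind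

theorem not_adj_of_adapted {G : SimpleGraph I} (i : I) (ω : List I) :
    ∀ (O : I → I → Bool), IsOrientation G O → IsSource G O i → IsAdapted G O ω → i ∉ ω →
      ∀ j ∈ ω, ¬ G.Adj i j := by
  induction ω with
  | nil => simp
  | cons a ω ih =>
    intro O hO hi ha hmem j hj
    rw [isAdapted_cons] at ha
    have hna := not_adj_of_sources hO hi ha.1
    have hne : i ≠ a := fun h => hmem (by simp [h])
    rcases List.mem_cons.1 hj with rfl | hj
    · exact hna
    · exact ih _ (isOrientation_reverseAt hO a) (isSource_reverseAt hne hna hi) ha.2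
        (fun h => hmem (List.mem_cons_of_mem _ h)) j hj

theorem commMove_cons {G : SimpleGraph I} (a : I) {ω ω' : List I}
    (h : Relation.ReflTransGen (CommMove G) ω ω') :
    Relation.ReflTransGen (CommMove G) (a :: ω) (a :: ω') := by
  induction h with
  | refl => exact .refl
  | tail _ h ih =>
    obtain ⟨l₁, l₂, i, j, hij, rfl, rfl⟩ := h
    exact ih.tail ⟨a :: l₁, l₂, i, j, hij, rfl, rfl⟩

theorem move_front {G : SimpleGraph I} (i : I) (b : List I) (a : List I) :
    ∀ (O : I → I → Bool), IsOrientation G O → IsSource G O i → IsAdapted G O (a ++ i :: b) →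
      i ∉ a → IsAdapted G (reverseAt i O) (a ++ b) ∧
        Relation.ReflTransGen (CommMove G) (i :: (a ++ b)) (a ++ i :: b) := by
  induction a with
  | nil =>
    intro O hO hi ha _
    exact ⟨((isAdapted_cons _ _ _ _).1 ha).2, .refl⟩
  | cons c a ih =>
    intro O hO hi ha hmem
    rw [List.cons_append, isAdapted_cons] at ha
    have hna := not_adj_of_sources hO hi ha.1
    have hne : i ≠ c := fun h => hmem (by simp [h])
    obtain ⟨h1, h2⟩ := ih _ (isOrientation_reverseAt hO c) (isSource_reverseAt hne hna hi) ha.2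
        (fun h => hmem (List.mem_cons_of_mem _ h))
    refine ⟨?_, ?_⟩
    · rw [List.cons_append, isAdapted_cons]
      refine ⟨isSource_reverseAt hne.symm (fun h => hna h.symm) ha.1, ?_⟩
      rwa [reverseAt_comm hne.symm]
    · refine Relation.ReflTransGen.head ?_ (commMove_cons c h2)
      exact ⟨[], a ++ b, i, c, hna, rfl, rfl⟩

variable {W : Type*} [Group W]

theorem simple_comm {G : SimpleGraph I} [DecidableRel G.Adj]
    (cs : CoxeterSystem (coxeterMatrixOfGraph G) W) {i j : I} (h : ¬ G.Adj i j) :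
    cs.simple i * cs.simple j = cs.simple j * cs.simple i := by
  by_cases hij : i = j
  · rw [hij]
  have h1 := cs.simple_mul_simple_pow i j
  rw [cmg_apply, if_neg hij, if_neg h, pow_two] at h1
  have h2 := eq_inv_of_mul_eq_one_left h1
  simpa using h2

theorem simple_braid {G : SimpleGraph I} [DecidableRel G.Adj]
    (cs : CoxeterSystem (coxeterMatrixOfGraph G) W) {i j : I} (h : G.Adj i j) :
    cs.simple i * cs.simple j * cs.simple i = cs.simple j * cs.simple i * cs.simple j := by
  have h1 := cs.simple_mul_simple_pow i j
  rw [cmg_apply, if_neg h.ne, if_pos h, pow_succ, pow_two] at h1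
  have h2 : cs.simple i * cs.simple j * cs.simple i * (cs.simple j * cs.simple i * cs.simple j)
      = 1 := by simpa only [mul_assoc] using h1
  have h3 := eq_inv_of_mul_eq_one_left h2
  simpa [mul_assoc] using h3

theorem wordProd_commMove {G : SimpleGraph I} [DecidableRel G.Adj]
    (cs : CoxeterSystem (coxeterMatrixOfGraph G) W) {ω ω' : List I}
    (h : Relation.ReflTransGen (CommMove G) ω ω') : cs.wordProd ω = cs.wordProd ω' := by
  induction h with
  | refl => rfl
  | tail _ h ih =>
    obtain ⟨l₁, l₂, i, j, hij, rfl, rfl⟩ := h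
    rw [ih]
    simp only [cs.wordProd_append, cs.wordProd_cons]
    rw [← mul_assoc (cs.simple i), simple_comm cs hij, mul_assoc]

/-- The contragredient of the reflection representation. -/
def numbersGame (G : SimpleGraph I) [DecidableRel G.Adj] (i : I) : Function.End (I → ℤ) :=
  fun f k => if k = i then - f i else if G.Adj i k then f k + f i else f k

theorem numbersGame_liftable (G : SimpleGraph I) [DecidableRel G.Adj] :
    (coxeterMatrixOfGraph G).IsLiftable (numbersGame G) := by
  intro i j
  rw [cmg_apply]
  by_cases hij : i = j
  · subst hij
    rw [if_pos rfl, pow_one]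
    funext f k
    change numbersGame G i (numbersGame G i f) k = f k
    unfold numbersGame
    by_cases hk : k = i
    · simp [hk]
    · by_cases h : G.Adj i k <;> simp [hk, h]
  · have hji : j ≠ i := fun h => hij h.symm
    rw [if_neg hij]
    by_cases h : G.Adj i j
    · have h' := h.symm
      rw [if_pos h]
      funext f k
      change numbersGame G i (numbersGame G j (numbersGame G i (numbersGame G j
        (numbersGame G i (numbersGame G j f))))) k = f k
      unfold numbersGame
      by_cases hk : k = i
      · simp [hk, h, h', hij, hji]
      · by_cases hk' : k = j
        · simp [hk', h, h', hij, hji]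
        · by_cases h1 : G.Adj i k <;> by_cases h2 : G.Adj j k <;>
            simp [hk, hk', h, h', h1, h2, hij, hji] <;> ring
    · have h' : ¬ G.Adj j i := fun h' => h h'.symm
      rw [if_neg h]
      funext f k
      change numbersGame G i (numbersGame G j (numbersGame G i (numbersGame G j f))) k = f k
      unfold numbersGame
      by_cases hk : k = i
      · simp [hk, h, h', hij, hji]
      · by_cases hk' : k = j
        · simp [hk', h, h', hij, hji]
        · by_cases h1 : G.Adj i k <;> by_cases h2 : G.Adj j k <;>
            simp [hk, hk', h, h', h1, h2, hij, hji] <;> ring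

theorem simple_inj {G : SimpleGraph I} [DecidableRel G.Adj]
    (cs : CoxeterSystem (coxeterMatrixOfGraph G) W) {i j : I} (hadj : ¬ G.Adj j i)
    (h : cs.simple i = cs.simple j) : i = j := by
  by_contra hij
  have h1 : numbersGame G i = numbersGame G j := by
    rw [← cs.lift_apply_simple (numbersGame_liftable G) i,
      ← cs.lift_apply_simple (numbersGame_liftable G) j, h]
  have h2 := congrFun (congrFun h1 (fun _ => 1)) i
  simp [numbersGame, hij, hadj] at h2

open Classical in
/-- The action on reflections with signs. -/
noncomputable def signedConj {G : SimpleGraph I} [DecidableRel G.Adj]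
    (cs : CoxeterSystem (coxeterMatrixOfGraph G) W) (i : I) : Function.End (W × ZMod 2) :=
  fun p => (cs.simple i * p.1 * cs.simple i, p.2 + if p.1 = cs.simple i then 1 else 0)

theorem conj_eq_iff {G : SimpleGraph I} [DecidableRel G.Adj]
    (cs : CoxeterSystem (coxeterMatrixOfGraph G) W) (i : I) (t u : W) :
    cs.simple i * t * cs.simple i = u ↔ t = cs.simple i * u * cs.simple i := by
  constructor
  · rintro rfl; simp [mul_assoc]
  · rintro rfl; simp [mul_assoc]

theorem signedConj_liftable {G : SimpleGraph I} [DecidableRel G.Adj]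
    (cs : CoxeterSystem (coxeterMatrixOfGraph G) W) :
    (coxeterMatrixOfGraph G).IsLiftable (signedConj cs) := by
  classical
  have two : ∀ x : ZMod 2, x + x = 0 := by decide
  intro i j
  rw [cmg_apply]
  by_cases hij : i = j
  · subst hij
    rw [if_pos rfl, pow_one]
    funext p
    change signedConj cs i (signedConj cs i p) = p
    ext
    · simp [signedConj, mul_assoc]
    · simp only [signedConj, conj_eq_iff]
      simp only [CoxeterSystem.simple_mul_simple_self, one_mul, add_assoc, two, add_zero]
  · rw [if_neg hij]
    by_cases h : G.Adj i j
    · rw [if_pos h]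
      have hb := simple_braid cs h
      have hp := cs.simple_mul_simple_pow i j
      have hp' := cs.simple_mul_simple_pow j i
      rw [cmg_apply, if_neg h.ne, if_pos h] at hp
      rw [cmg_apply, if_neg h.ne.symm, if_pos h.symm] at hp'
      funext p
      change signedConj cs i (signedConj cs j (signedConj cs i (signedConj cs j
        (signedConj cs i (signedConj cs j p))))) = p
      generalize hsi : cs.simple i = a at *
      generalize hsj : cs.simple j = b at *
      have ha : a * a = 1 := by rw [← hsi]; simp
      have hbb : b * b = 1 := by rw [← hsj]; simp
      ext
      · simp only [signedConj, hsi, hsj]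
        have e : a * (b * (a * (b * (a * (b * p.1 * b) * a) * b) * a) * b) * a
            = (a * b) ^ 3 * p.1 * (b * a) ^ 3 := by simp only [pow_succ, pow_zero, one_mul, mul_assoc]
        try simp only [e, hp, hp', one_mul, mul_one]
      · have c1 : b * a * b = a * b * a := hb.symm
        have ha' : ∀ x, a * (a * x) = x := fun x => by rw [← mul_assoc, ha, one_mul]
        have hb' : ∀ x, b * (b * x) = x := fun x => by rw [← mul_assoc, hbb, one_mul]
        have c2 : b * (a * b * a) * b = a := by rw [hb]; simp [mul_assoc, hbb, hb']
        have c3 : a * (a * b * a) * a = b := by simp [mul_assoc, ha, ha']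
        have ca : ∀ t u, a * t * a = u ↔ t = a * u * a := by
          intro t u; rw [← hsi]; exact conj_eq_iff cs i t u
        have cb : ∀ t u, b * t * b = u ↔ t = b * u * b := by
          intro t u; rw [← hsj]; exact conj_eq_iff cs j t u
        have d1 : a * a * a = a := by simp [ha]
        have d2 : b * b * b = b := by simp [hbb]
        simp only [signedConj, hsi, hsj, ca, cb, c2, c3, d1, d2, c1]
        generalize (if p.1 = b then (1 : ZMod 2) else 0) = x
        generalize (if p.1 = a then (1 : ZMod 2) else 0) = y
        generalize (if p.1 = a * b * a then (1 : ZMod 2) else 0) = z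
        generalize p.2 = q
        revert x y z q
        decide
    · rw [if_neg h]
      have hc := simple_comm cs h
      funext p
      change signedConj cs i (signedConj cs j (signedConj cs i (signedConj cs j p))) = p
      generalize hsi : cs.simple i = a at *
      generalize hsj : cs.simple j = b at *
      have ha : a * a = 1 := by rw [← hsi]; simp
      have hbb : b * b = 1 := by rw [← hsj]; simp
      have ha' : ∀ x, a * (a * x) = x := fun x => by rw [← mul_assoc, ha, one_mul]
      have hb' : ∀ x, b * (b * x) = x := fun x => by rw [← mul_assoc, hbb, one_mul]
      ext
      · simp only [signedConj, hsi, hsj]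
        have hp : a * b * (a * b) = 1 := by nth_rw 2 [hc]; simp [mul_assoc, hb', ha]
        have hp' : b * a * (b * a) = 1 := by rw [← hc]; exact hp
        have e : a * (b * (a * (b * p.1 * b) * a) * b) * a
            = (a * b * (a * b)) * p.1 * (b * a * (b * a)) := by simp only [mul_assoc]
        rw [e, hp, hp', one_mul, mul_one]
      · have ca : ∀ t u, a * t * a = u ↔ t = a * u * a := by
          intro t u; rw [← hsi]; exact conj_eq_iff cs i t u
        have cb : ∀ t u, b * t * b = u ↔ t = b * u * b := by
          intro t u; rw [← hsj]; exact conj_eq_iff cs j t u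
        have d1 : a * b * a = b := by rw [hc, mul_assoc, ha, mul_one]
        have d2 : b * a * b = a := by rw [← hc, mul_assoc, hbb, mul_one]
        have d3 : b * b * b = b := by simp [hbb]
        have d4 : a * a * a = a := by simp [ha]
        simp only [signedConj, hsi, hsj, ca, cb, d1, d2, d3, d4]
        generalize (if p.1 = b then (1 : ZMod 2) else 0) = x
        generalize (if p.1 = a then (1 : ZMod 2) else 0) = y
        generalize p.2 = q
        revert x y q
        decide

open Classical in
theorem lift_signedConj {G : SimpleGraph I} [DecidableRel G.Adj]
    (cs : CoxeterSystem (coxeterMatrixOfGraph G) W) (ω : List I) (t : W) :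
    (cs.lift ⟨signedConj cs, signedConj_liftable cs⟩ (cs.wordProd ω) : Function.End (W × ZMod 2))
      (t, 0) = (cs.wordProd ω * t * (cs.wordProd ω)⁻¹, ((cs.rightInvSeq ω).count t : ZMod 2)) := by
  induction ω with
  | nil => simp; rfl
  | cons i ω ih =>
    rw [cs.wordProd_cons, map_mul, cs.lift_apply_simple]
    change signedConj cs i ((cs.lift ⟨signedConj cs, signedConj_liftable cs⟩ (cs.wordProd ω) :
      Function.End (W × ZMod 2)) (t, 0)) = _
    rw [ih]
    have key : (cs.wordProd ω * t * (cs.wordProd ω)⁻¹ = cs.simple i) ↔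
        ((cs.wordProd ω)⁻¹ * cs.simple i * cs.wordProd ω = t) := by
      constructor
      · intro h; rw [← h]; group
      · intro h; rw [← h]; group
    ext
    · simp [signedConj, mul_assoc]
    · simp only [signedConj, key, CoxeterSystem.rightInvSeq, List.count_cons, beq_iff_eq]
      push_cast
      rfl

theorem mem_leftInvSeq_of_eq {G : SimpleGraph I} [DecidableRel G.Adj]
    (cs : CoxeterSystem (coxeterMatrixOfGraph G) W) {ω ω' : List I}
    (h : cs.wordProd ω = cs.wordProd ω') (hr : cs.IsReduced ω) {t : W}
    (ht : t ∈ cs.leftInvSeq ω) : t ∈ cs.leftInvSeq ω' := by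
  classical
  have hrev : cs.wordProd ω.reverse = cs.wordProd ω'.reverse := by
    rw [cs.wordProd_reverse, cs.wordProd_reverse, h]
  have h1 := lift_signedConj cs ω.reverse t
  rw [hrev, lift_signedConj cs ω'.reverse t] at h1
  have h2 := congrArg Prod.snd h1
  simp only [cs.rightInvSeq_reverse, List.count_reverse] at h2
  rw [List.count_eq_one_of_mem hr.nodup_leftInvSeq ht] at h2
  by_contra hn
  rw [List.count_eq_zero_of_not_mem hn] at h2
  simp at h2

theorem first_mem {G : SimpleGraph I} [DecidableRel G.Adj]
    (cs : CoxeterSystem (coxeterMatrixOfGraph G) W) {i : I} {ω ω' : List I}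
    {O : I → I → Bool} (hO : IsOrientation G O) (hi : IsSource G O i)
    (h : cs.wordProd (i :: ω) = cs.wordProd ω') (hr : cs.IsReduced (i :: ω))
    (ha : IsAdapted G O ω') : i ∈ ω' := by
  by_contra hn
  have hna := not_adj_of_adapted i ω' O hO hi ha hn
  have hm : cs.simple i ∈ cs.leftInvSeq ω' :=
    mem_leftInvSeq_of_eq cs h hr (by simp [CoxeterSystem.leftInvSeq])
  obtain ⟨k, hk, hk'⟩ := List.mem_iff_getElem.1 hm
  have hk2 : k < ω'.length := by simpa using hk
  rw [cs.getElem_leftInvSeq ω' k hk2] at hk'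
  have hcomm : ∀ l : List I, (∀ j ∈ l, ¬ G.Adj i j) →
      cs.simple i * cs.wordProd l = cs.wordProd l * cs.simple i := by
    intro l
    induction l with
    | nil => simp
    | cons a l ih =>
      intro hl
      rw [cs.wordProd_cons, ← mul_assoc, simple_comm cs (hl a (by simp)), mul_assoc,
        ih (fun j hj => hl j (List.mem_cons_of_mem _ hj)), mul_assoc]
  have hc := hcomm (ω'.take k) (fun j hj => hna j (List.mem_of_mem_take hj))
  rw [mul_inv_eq_iff_eq_mul, hc] at hk'
  have heq := mul_left_cancel hk'
  have hmem : ω'[k] ∈ ω' := List.getElem_mem hk2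
  have := simple_inj cs (hna _ hmem) heq
  exact hn (this ▸ hmem)

theorem adapted_aux {G : SimpleGraph I} [DecidableRel G.Adj]
    (cs : CoxeterSystem (coxeterMatrixOfGraph G) W) (ω : List I) :
    ∀ (O : I → I → Bool) (ω' : List I), IsOrientation G O →
      cs.wordProd ω = cs.wordProd ω' → cs.IsReduced ω → cs.IsReduced ω' →
      IsAdapted G O ω → IsAdapted G O ω' → Relation.ReflTransGen (CommMove G) ω ω' := by
  induction ω with
  | nil =>
    intro O ω' _ h hr hr' _ _
    have : ω'.length = 0 := by rw [← hr'.eq, ← h]; simp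
    rw [List.length_eq_zero_iff.1 this]
  | cons i ω ih =>
    intro O ω' hO h hr hr' ha ha'
    rw [isAdapted_cons] at ha
    have hmem := first_mem cs hO ha.1 h hr ha'
    obtain ⟨a, b, hab, hna⟩ : ∃ a b, ω' = a ++ i :: b ∧ i ∉ a := by
      obtain ⟨a, b, h1, h2⟩ := List.eq_append_cons_of_mem hmem
      exact ⟨a, b, h1, h2⟩
    subst hab
    obtain ⟨h1, h2⟩ := move_front i b a O hO ha.1 ha' hna
    have hp := wordProd_commMove cs h2
    rw [← h, cs.wordProd_cons, cs.wordProd_cons] at hp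
    have hp' := mul_left_cancel hp
    have hrω : cs.IsReduced ω := by simpa using hr.drop 1
    have hlen : (a ++ b).length = ω.length := by
      have e1 := hr.eq
      have e2 := hr'.eq
      rw [h, e2] at e1
      simp at e1 ⊢
      omega
    have hrab : cs.IsReduced (a ++ b) := by
      unfold CoxeterSystem.IsReduced
      rw [hp', hlen]
      exact hrω
    exact (commMove_cons i (ih _ _ (isOrientation_reverseAt hO i) hp'.symm hrω hrab ha.2 h1)).trans h2

end AdaptedHelpers

/-- any two reduced words for the longest element `w₀` that are adapted to
the same orientation `Ω` of a simply-laced Dynkin diagram `Γ` (a connected simple graph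
whose Coxeter group `W` is finite, i.e. type A, D or E) are related by a finite sequence
of commutation moves, each exchanging two adjacent letters not joined by an edge of `Γ`. -/
theorem adapted_reduced_words_related_by_commutation_moves
    (G : SimpleGraph I) [DecidableRel G.Adj] (hconn : G.Connected)
    {W : Type*} [Group W] [Finite W]
    (cs : CoxeterSystem (coxeterMatrixOfGraph G) W)
    (w₀ : W) (hw₀ : ∀ w : W, cs.length w ≤ cs.length w₀)
    (O : I → I → Bool) (hO : IsOrientation G O)
    (ω ω' : List I)
    (hω : cs.wordProd ω = w₀ ∧ cs.IsReduced ω ∧ IsAdapted G O ω)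
    (hω' : cs.wordProd ω' = w₀ ∧ cs.IsReduced ω' ∧ IsAdapted G O ω') :
    Relation.ReflTransGen (CommMove G) ω ω' := by
  exact adapted_aux cs ω O ω' hO (hω.1.trans hω'.1.symm) hω.2.1 hω'.2.1 hω.2.2 hω'.2.2
end

section
/- For every reduced expression w₀ = s_{i₁} s_{i₂} ⋯ s_{i_l} of the longest element, the automorphism τ = τ_{i₁} ∘ τ_{i₂} ∘ ⋯ ∘ τ_{i_l} of g satisfies τ(e_{iˇ}) = −f_i for every i, where iˇ is defined by α_{iˇ} = −w₀(α_i). (This is the classical, q = 1, specialization of the identity T_{w₀}(E_{iˇ}) = −F_i K_i for the braid group operators on the quantum group.) -/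
variable {I : Type*} [Fintype I] [DecidableEq I]
variable {L : Type*} [LieRing L] [LieAlgebra ℂ L] [FiniteDimensional ℂ L]

/-- `A` is a Cartan matrix of simply-laced (A, D, E) type: symmetric, with diagonal
entries `2`, off-diagonal entries `0` or `-1` (so `A i j = (αᵢ, αⱼ)` for the inner
product normalized by `(α, α) = 2`), and connected Dynkin diagram. -/
structure IsADECartanMatrix (A : Matrix I I ℤ) : Prop where
  symm : ∀ i j, A i j = A j i
  diag : ∀ i, A i i = 2
  off_diag : ∀ i j, i ≠ j → A i j = 0 ∨ A i j = -1
  connected : (SimpleGraph.fromRel fun i j => A i j = -1).Connected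

/-- The data of a simple Lie algebra `L` over `ℂ` of type A, D or E together with a
splitting Cartan subalgebra and Chevalley generators `eᵢ ∈ g_{αᵢ}`, `fᵢ ∈ g_{-αᵢ}`,
`hᵢ = [eᵢ, fᵢ]` the coroots, recorded via the standard Chevalley–Serre relations. -/
structure IsChevalleySystem (A : Matrix I I ℤ) (e f h : I → L) : Prop where
  cartan : IsADECartanMatrix A
  simple : LieAlgebra.IsSimple ℂ L
  lie_h_h : ∀ i j, ⁅h i, h j⁆ = 0
  lie_e_f : ∀ i j, ⁅e i, f j⁆ = if i = j then h i else 0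
  lie_h_e : ∀ i j, ⁅h i, e j⁆ = (A i j : ℂ) • e j
  lie_h_f : ∀ i j, ⁅h i, f j⁆ = -(A i j : ℂ) • f j
  serre_e : ∀ i j, i ≠ j → ((LieAlgebra.ad ℂ L (e i)) ^ (1 - A i j).toNat) (e j) = 0
  serre_f : ∀ i j, i ≠ j → ((LieAlgebra.ad ℂ L (f i)) ^ (1 - A i j).toNat) (f j) = 0
  generates : LieSubalgebra.lieSpan ℂ L (Set.range e ∪ Set.range f) = ⊤
  ad_e_nilpotent : ∀ i, IsNilpotent (LieAlgebra.ad ℂ L (e i))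
  ad_f_nilpotent : ∀ i, IsNilpotent (LieAlgebra.ad ℂ L (f i))

/-- The exponential of a (nilpotent) endomorphism `a` of the finite-dimensional space `L`:
`exp a = ∑ aⁿ/n!`, where the sum may be truncated at `n = finrank ℂ L` since `a` is
nilpotent. -/
noncomputable def expEnd (a : Module.End ℂ L) : Module.End ℂ L :=
  ∑ n ∈ Finset.range (Module.finrank ℂ L + 1), (n.factorial : ℂ)⁻¹ • a ^ n

/-- The automorphism `τᵢ = exp(ad eᵢ) ∘ exp(−ad fᵢ) ∘ exp(ad eᵢ)` of `L`, implementing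
the simple reflection `sᵢ` on the Cartan subalgebra. -/
noncomputable def chevalleyTau (e f : I → L) (i : I) : Module.End ℂ L :=
  expEnd (LieAlgebra.ad ℂ L (e i)) * expEnd (-(LieAlgebra.ad ℂ L (f i))) *
    expEnd (LieAlgebra.ad ℂ L (e i))

/-- The composition `τ_{i₁} ∘ τ_{i₂} ∘ ⋯ ∘ τ_{i_l}` along a word `ω = (i₁, …, i_l)`. -/
noncomputable def tauWord (e f : I → L) (ω : List I) : Module.End ℂ L :=
  (ω.map (chevalleyTau e f)).prod

/-- The Coxeter matrix of the Weyl group attached to the Cartan matrix `A`: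
`m i j = 1` if `i = j`, `3` if `A i j = -1`, and `2` otherwise. -/
def coxeterMatrixOfCartan (A : Matrix I I ℤ) : CoxeterMatrix I where
  M := Matrix.of fun i j =>
    if i = j then 1 else if A i j = -1 ∨ A j i = -1 then 3 else 2
  isSymm := by
    unfold Matrix.IsSymm
    ext i j
    by_cases h : i = j
    · simp [h]
    · simp only [Matrix.transpose_apply, Matrix.of_apply, if_neg h, if_neg (Ne.symm h)]
      by_cases h' : A i j = -1 ∨ A j i = -1
      · rw [if_pos h', if_pos (Or.symm h')]
      · rw [if_neg h', if_neg (fun hc => h' (Or.symm hc))]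
  diagonal := by intro i; simp
  off_diagonal := by
    intro i j h
    simp only [Matrix.of_apply, if_neg h]
    split <;> omega


namespace TauAux

/-- the linear functional `v ↦ ⟨v, αᵢ⟩` on the root lattice -/
noncomputable def aF (A : Matrix I I ℤ) (i : I) : (I → ℤ) →ₗ[ℤ] ℤ :=
  ∑ k, A i k • LinearMap.proj k

/-- simple root -/
def rt (i : I) : I → ℤ := Pi.single i 1

theorem aF_rt (A : Matrix I I ℤ) (i j : I) : aF A i (rt j) = A i j := by
  simp [aF, rt, Pi.single_apply]

/-- simple reflection on the root lattice -/
noncomputable def sR (A : Matrix I I ℤ) (i : I) : Module.End ℤ (I → ℤ) :=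
  1 - (aF A i).smulRight (rt i)

theorem sR_apply (A : Matrix I I ℤ) (i : I) (v : I → ℤ) :
    sR A i v = v - aF A i v • rt i := rfl

theorem sR_sq {A : Matrix I I ℤ} (hA : IsADECartanMatrix A) (i : I) : sR A i * sR A i = 1 := by
  refine LinearMap.ext fun v => ?_
  simp only [Module.End.mul_apply, sR_apply, map_sub, map_smul, aF_rt, hA.diag,
    smul_eq_mul, Module.End.one_apply]
  module

theorem sR_comm {A : Matrix I I ℤ} (hA : IsADECartanMatrix A) (i j : I) (hij : A i j = 0) :
    sR A i * sR A j = sR A j * sR A i := by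
  have hji : A j i = 0 := by rw [hA.symm, hij]
  refine LinearMap.ext fun v => ?_
  simp only [Module.End.mul_apply, sR_apply, map_sub, map_smul, aF_rt, hij, hji]
  module

theorem sR_braid {A : Matrix I I ℤ} (hA : IsADECartanMatrix A) (i j : I) (hij : A i j = -1) :
    sR A i * sR A j * sR A i = sR A j * sR A i * sR A j := by
  have hji : A j i = -1 := by rw [hA.symm, hij]
  refine LinearMap.ext fun v => ?_
  simp only [Module.End.mul_apply, sR_apply, map_sub, map_smul, aF_rt, hij, hji,
    hA.diag]
  module

theorem sR_liftable {A : Matrix I I ℤ} (hA : IsADECartanMatrix A) :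
    (coxeterMatrixOfCartan A).IsLiftable (sR A) := by
  intro i j
  have hM : (coxeterMatrixOfCartan A).M i j =
    if i = j then 1 else if A i j = -1 ∨ A j i = -1 then 3 else 2 := rfl
  change (sR A i * sR A j) ^ ((coxeterMatrixOfCartan A).M i j) = 1
  rw [hM]
  split_ifs with h1 h2
  · subst h1; rw [pow_one, sR_sq hA]
  · have hij : A i j = -1 := by
      rcases h2 with h | h
      · exact h
      · rw [hA.symm, h]
    calc (sR A i * sR A j) ^ 3
        = (sR A i * sR A j * sR A i) * (sR A j * sR A i * sR A j) := by
          simp only [pow_succ, pow_zero, one_mul, mul_assoc]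
      _ = (sR A i * sR A j * sR A i) * (sR A i * sR A j * sR A i) := by
          rw [sR_braid hA i j hij]
      _ = sR A i * sR A j * (sR A i * sR A i) * sR A j * sR A i := by simp only [mul_assoc]
      _ = sR A i * (sR A j * sR A j) * sR A i := by
          rw [sR_sq hA i, mul_one]; simp only [mul_assoc]
      _ = 1 := by rw [sR_sq hA, mul_one, sR_sq hA]
  · have hij : A i j = 0 := (hA.off_diag i j h1).resolve_right (fun h => h2 (Or.inl h))
    calc (sR A i * sR A j) ^ 2
        = (sR A i * sR A j) * (sR A j * sR A i) := by rw [← sR_comm hA i j hij, pow_two]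
      _ = sR A i * (sR A j * sR A j) * sR A i := by simp only [mul_assoc]
      _ = 1 := by rw [sR_sq hA, mul_one, sR_sq hA]

/-- the reflection representation -/
noncomputable def rep {A : Matrix I I ℤ} (hA : IsADECartanMatrix A)
    {W : Type*} [Group W] (cs : CoxeterSystem (coxeterMatrixOfCartan A) W)
   : W →* Module.End ℤ (I → ℤ) := cs.lift ⟨sR A, sR_liftable hA⟩

theorem rep_simple {A : Matrix I I ℤ} (hA : IsADECartanMatrix A)
    {W : Type*} [Group W] (cs : CoxeterSystem (coxeterMatrixOfCartan A) W)
   (i : I) : rep hA cs (cs.simple i) = sR A i :=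
  cs.lift_apply_simple (sR_liftable hA) i

theorem rep_mul {A : Matrix I I ℤ} (hA : IsADECartanMatrix A)
    {W : Type*} [Group W] (cs : CoxeterSystem (coxeterMatrixOfCartan A) W)
   (w : W) (i : I) (v : I → ℤ) :
    rep hA cs (w * cs.simple i) v = rep hA cs w v - aF A i v • rep hA cs w (rt i) := by
  rw [map_mul, rep_simple, Module.End.mul_apply, sR_apply, map_sub, map_smul]

theorem rep_mul_rt {A : Matrix I I ℤ} (hA : IsADECartanMatrix A)
    {W : Type*} [Group W] (cs : CoxeterSystem (coxeterMatrixOfCartan A) W)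
   (w : W) (i j : I) :
    rep hA cs (w * cs.simple i) (rt j) =
      rep hA cs w (rt j) - A i j • rep hA cs w (rt i) := by
  rw [rep_mul, aF_rt]

theorem rep_mul_self {A : Matrix I I ℤ} (hA : IsADECartanMatrix A)
    {W : Type*} [Group W] (cs : CoxeterSystem (coxeterMatrixOfCartan A) W)
   (w : W) (i : I) :
    rep hA cs (w * cs.simple i) (rt i) = - rep hA cs w (rt i) := by
  rw [rep_mul_rt, hA.diag]; module

theorem rep_inj {A : Matrix I I ℤ} (hA : IsADECartanMatrix A)
    {W : Type*} [Group W] (cs : CoxeterSystem (coxeterMatrixOfCartan A) W)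
   (w : W) (v : I → ℤ) (h : rep hA cs w v = 0) : v = 0 := by
  have : rep hA cs (w⁻¹ * w) v = 0 := by rw [map_mul, Module.End.mul_apply, h, map_zero]
  simpa using this

theorem rt_ne (i : I) : (rt i : I → ℤ) ≠ 0 := by
  intro h
  have := congrFun h i
  simp [rt] at this

theorem simple_comm {A : Matrix I I ℤ} (hA : IsADECartanMatrix A)
    {W : Type*} [Group W] (cs : CoxeterSystem (coxeterMatrixOfCartan A) W)
   (i j : I) (hne : i ≠ j) (hij : A i j = 0) :
    cs.simple i * cs.simple j = cs.simple j * cs.simple i := by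
  have h := cs.simple_mul_simple_pow i j
  have hM : (coxeterMatrixOfCartan A) i j = 2 := by
    change (if i = j then 1 else if A i j = -1 ∨ A j i = -1 then 3 else 2) = 2
    rw [hA.symm j i]; simp [hne, hij]
  rw [hM, pow_two] at h
  have := eq_inv_of_mul_eq_one_left h
  simpa using this

theorem simple_braid {A : Matrix I I ℤ} (hA : IsADECartanMatrix A)
    {W : Type*} [Group W] (cs : CoxeterSystem (coxeterMatrixOfCartan A) W)
   (i j : I) (hne : i ≠ j) (hij : A i j = -1) :
    cs.simple i * cs.simple j * cs.simple i = cs.simple j * cs.simple i * cs.simple j := by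
  have h := cs.simple_mul_simple_pow i j
  have hM : (coxeterMatrixOfCartan A) i j = 3 := by
    change (if i = j then 1 else if A i j = -1 ∨ A j i = -1 then 3 else 2) = 3
    simp [hne, hij]
  rw [hM] at h
  have h' : (cs.simple i * cs.simple j * cs.simple i) *
      (cs.simple j * cs.simple i * cs.simple j) = 1 := by
    rw [← h]; simp only [pow_succ, pow_zero, one_mul, mul_assoc]
  have := eq_inv_of_mul_eq_one_left h'
  simpa [mul_assoc] using this

theorem rep_nonneg {A : Matrix I I ℤ} (hA : IsADECartanMatrix A)
    {W : Type*} [Group W] (cs : CoxeterSystem (coxeterMatrixOfCartan A) W)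
   : ∀ (n : ℕ) (w : W) (i : I), cs.length w = n →
    cs.length w < cs.length (w * cs.simple i) → 0 ≤ rep hA cs w (rt i) := by
  intro n
  induction n using Nat.strong_induction_on with
  | _ n ih =>
  intro w i hn hlt
  by_cases hw : w = 1
  · subst hw
    rw [map_one]
    intro k
    simp only [rt, Module.End.one_apply, Pi.single_apply, Pi.zero_apply]
    split_ifs <;> norm_num
  obtain ⟨k, hk⟩ := cs.exists_rightDescent_of_ne_one hw
  have hk' := hk
  rw [cs.isRightDescent_iff] at hk'
  have hki : k ≠ i := by
    rintro rfl
    exact absurd hk (by unfold CoxeterSystem.IsRightDescent; omega)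
  obtain ⟨u, hu⟩ : ∃ u, u = w * cs.simple k := ⟨_, rfl⟩
  have hwu : w = u * cs.simple k := by rw [hu]; simp
  rw [← hu] at hk'
  have huk : cs.length u < cs.length (u * cs.simple k) := by rw [← hwu]; omega
  rcases hA.off_diag k i hki with h0 | h1
  · have hi : cs.length u < cs.length (u * cs.simple i) := by
      have : u * cs.simple i * cs.simple k = w * cs.simple i := by
        rw [hwu, mul_assoc, mul_assoc, simple_comm hA cs k i hki h0]
      have h2 := cs.length_mul_simple (u * cs.simple i) k
      rw [this] at h2
      omega
    have := ih _ (by omega) u i rfl hi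
    rwa [hwu, rep_mul_rt, h0, zero_smul, sub_zero]
  · have hik : A i k = -1 := by rw [hA.symm, h1]
    rcases cs.length_mul_simple u i with hi | hi
    · have e1 := ih _ (by omega) u i rfl (by omega)
      have e2 := ih _ (by omega) u k rfl huk
      rw [hwu, rep_mul_rt, h1, neg_smul, one_smul, sub_neg_eq_add]
      exact add_nonneg e1 e2
    · obtain ⟨v, hv⟩ : ∃ v, v = u * cs.simple i := ⟨_, rfl⟩
      have huv : u = v * cs.simple i := by rw [hv]; simp
      rw [← hv] at hi
      have hvk : cs.length v < cs.length (v * cs.simple k) := by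
        by_contra hcon
        have h2 : v * cs.simple k * cs.simple i * cs.simple k = w * cs.simple i := by
          rw [hwu, huv]
          have := simple_braid hA cs k i hki h1
          simp only [mul_assoc] at this ⊢
          rw [this]
        have h3 := cs.length_mul_simple v k
        have h4 := cs.length_mul_simple (v * cs.simple k) i
        have h5 := cs.length_mul_simple (v * cs.simple k * cs.simple i) k
        rw [h2] at h5
        omega
      have e2 := ih _ (by omega) v k rfl hvk
      have : rep hA cs w (rt i) = rep hA cs v (rt k) := by
        rw [hwu, rep_mul_rt, h1, huv, rep_mul_self, rep_mul_rt, hik]; module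
      rw [this]; exact e2

theorem rep_nonneg' {A : Matrix I I ℤ} (hA : IsADECartanMatrix A)
    {W : Type*} [Group W] (cs : CoxeterSystem (coxeterMatrixOfCartan A) W)
   (w : W) (i : I) (h : cs.length w < cs.length (w * cs.simple i)) :
    0 ≤ rep hA cs w (rt i) := rep_nonneg hA cs _ w i rfl h

theorem rep_nonpos {A : Matrix I I ℤ} (hA : IsADECartanMatrix A)
    {W : Type*} [Group W] (cs : CoxeterSystem (coxeterMatrixOfCartan A) W)
   (w : W) (i : I) (h : cs.length (w * cs.simple i) < cs.length w) :
    rep hA cs w (rt i) ≤ 0 := by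
  have := rep_nonneg' hA cs (w * cs.simple i) i (by simpa using h)
  rw [rep_mul_self] at this
  exact neg_nonneg.mp this

/-- dichotomy in commuting case -/
theorem descent_comm {A : Matrix I I ℤ} (hA : IsADECartanMatrix A)
    {W : Type*} [Group W] (cs : CoxeterSystem (coxeterMatrixOfCartan A) W)
   (w : W) (i j : I) (hij : A i j = 0)
    (hi : cs.length (w * cs.simple i) + 1 = cs.length w)
    (hj : cs.length (w * cs.simple j) + 1 = cs.length w) :
    cs.length (w * cs.simple i * cs.simple j) + 2 = cs.length w := by
  rcases cs.length_mul_simple (w * cs.simple i) j with h | h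
  · exfalso
    have h1 := rep_nonneg' hA cs (w * cs.simple i) j (by omega)
    rw [rep_mul_rt, hij, zero_smul, sub_zero] at h1
    have h2 := rep_nonpos hA cs w j (by omega)
    exact rt_ne j (rep_inj hA cs w _ (le_antisymm h2 h1))
  · omega

theorem descent_braid {A : Matrix I I ℤ} (hA : IsADECartanMatrix A)
    {W : Type*} [Group W] (cs : CoxeterSystem (coxeterMatrixOfCartan A) W)
   (w : W) (i j : I) (hne : i ≠ j) (hij : A i j = -1)
    (hi : cs.length (w * cs.simple i) + 1 = cs.length w)
    (hj : cs.length (w * cs.simple j) + 1 = cs.length w) :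
    cs.length (w * cs.simple i * cs.simple j * cs.simple i) + 3 = cs.length w := by
  have hji : A j i = -1 := by rw [hA.symm, hij]
  have hni := rep_nonpos hA cs w i (by omega)
  have hnj := rep_nonpos hA cs w j (by omega)
  rcases cs.length_mul_simple (w * cs.simple i) j with h | h
  · exfalso
    have h1 := rep_nonneg' hA cs (w * cs.simple i) j (by omega)
    rw [rep_mul_rt, hij, neg_smul, one_smul, sub_neg_eq_add] at h1
    have h2 := le_antisymm (add_nonpos hnj hni) h1
    rw [← map_add] at h2
    have h3 := congrFun (rep_inj hA cs w _ h2) i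
    simp [rt, hne] at h3
  · rcases cs.length_mul_simple (w * cs.simple i * cs.simple j) i with h' | h'
    · exfalso
      have h1 := rep_nonneg' hA cs (w * cs.simple i * cs.simple j) i (by omega)
      have h2 : rep hA cs (w * cs.simple i * cs.simple j) (rt i) = rep hA cs w (rt j) := by
        rw [rep_mul_rt, rep_mul_self, rep_mul_rt, hij, hji]; module
      rw [h2] at h1
      exact rt_ne j (rep_inj hA cs w _ (le_antisymm hnj h1))
    · omega

theorem matsumoto {A : Matrix I I ℤ} (hA : IsADECartanMatrix A)
    {W : Type*} [Group W] (cs : CoxeterSystem (coxeterMatrixOfCartan A) W)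
   {M : Type*} [Monoid M] (t : I → M)
    (hc : ∀ i j, i ≠ j → A i j = 0 → t i * t j = t j * t i)
    (hb : ∀ i j, i ≠ j → A i j = -1 → t i * t j * t i = t j * t i * t j) :
    ∀ (n : ℕ) (ω ω' : List I), ω.length = n → cs.IsReduced ω → cs.IsReduced ω' →
      cs.wordProd ω = cs.wordProd ω' → (ω.map t).prod = (ω'.map t).prod := by
  intro n
  induction n using Nat.strong_induction_on with
  | _ n ih =>
  intro ω ω' hn hr hr' hp
  have hlen : ω.length = ω'.length := by rw [← hr.eq, ← hr'.eq, hp]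
  have key : ∀ (ρ : List I) (i : I), cs.IsReduced (ρ ++ [i]) → cs.IsReduced ρ ∧
      cs.wordProd (ρ ++ [i]) = cs.wordProd ρ * cs.simple i ∧
      cs.wordProd ρ = cs.wordProd (ρ ++ [i]) * cs.simple i := by
    intro ρ i h
    refine ⟨by simpa using h.take ρ.length, ?_, ?_⟩
    · simp [cs.wordProd_append]
    · simp [cs.wordProd_append]
  have key2 : ∀ (ρ : List I) (i : I), cs.IsReduced ρ →
      cs.length (cs.wordProd ρ * cs.simple i) = ρ.length + 1 → cs.IsReduced (ρ ++ [i]) := by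
    intro ρ i _ h2
    unfold CoxeterSystem.IsReduced
    simp [cs.wordProd_append, h2]
  rcases List.eq_nil_or_concat ω with rfl | ⟨ρ, i, rfl⟩
  · have : ω' = [] := List.length_eq_zero_iff.mp (by simpa using hlen.symm)
    rw [this]
  rcases List.eq_nil_or_concat ω' with rfl | ⟨ρ', j, rfl⟩
  · simp at hlen
  rw [List.concat_eq_append] at *
  rw [List.concat_eq_append] at *
  obtain ⟨a1, a2, a3⟩ := key ρ i hr
  obtain ⟨b1, b2, b3⟩ := key ρ' j hr'
  have hlρ : ρ.length + 1 = n := by simpa using hn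
  have hlρ' : ρ'.length + 1 = n := by simpa [hn] using hlen.symm
  by_cases hij : i = j
  · subst hij
    have := ih ρ.length (by omega) ρ ρ' rfl a1 b1 (by rw [a3, b3, hp])
    simp [this]
  obtain ⟨w, hw⟩ : ∃ w, w = cs.wordProd (ρ ++ [i]) := ⟨_, rfl⟩
  have hwl : cs.length w = n := by rw [hw, hr.eq, hn]
  have hwi : cs.wordProd ρ = w * cs.simple i := by rw [a3, hw]
  have hwj : cs.wordProd ρ' = w * cs.simple j := by rw [b3, hw, hp]
  have hli : cs.length (w * cs.simple i) + 1 = cs.length w := by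
    rw [← hwi, a1.eq, hwl, hlρ]
  have hlj : cs.length (w * cs.simple j) + 1 = cs.length w := by
    rw [← hwj, b1.eq, hwl, hlρ']
  rcases hA.off_diag i j hij with h0 | h1
  · have hd := descent_comm hA cs w i j h0 hli hlj
    obtain ⟨κ, hκ, hκ'⟩ := cs.exists_isReduced (w * cs.simple i * cs.simple j)
    have hkl : κ.length + 2 = n := by rw [← hκ.eq, ← hκ', hd, hwl]
    have r1 : cs.wordProd κ * cs.simple j = w * cs.simple i := by rw [← hκ']; simp
    have r2 : cs.wordProd κ * cs.simple i = w * cs.simple j := by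
      rw [← hκ', mul_assoc w, simple_comm hA cs i j hij h0]; simp [mul_assoc]
    have q1 := ih ρ.length (by omega) ρ (κ ++ [j]) rfl a1
      (key2 κ j hκ (by rw [r1]; omega)) (by rw [cs.wordProd_append]; simp [r1, hwi])
    have q2 := ih ρ'.length (by omega) ρ' (κ ++ [i]) rfl b1
      (key2 κ i hκ (by rw [r2]; omega)) (by rw [cs.wordProd_append]; simp [r2, hwj])
    simp only [List.map_append, List.prod_append, q1, q2]
    simp [mul_assoc, hc i j hij h0]
  · have hd := descent_braid hA cs w i j hij h1 hli hlj
    obtain ⟨κ, hκ, hκ'⟩ := cs.exists_isReduced (w * cs.simple i * cs.simple j * cs.simple i)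
    have hkl : κ.length + 3 = n := by rw [← hκ.eq, ← hκ', hd, hwl]
    have r1 : cs.wordProd κ * cs.simple i * cs.simple j = w * cs.simple i := by
      rw [← hκ']; simp
    have r2 : cs.wordProd κ * cs.simple j * cs.simple i = w * cs.simple j := by
      have := simple_braid hA cs i j hij h1
      rw [← hκ']
      calc _ = w * (cs.simple i * cs.simple j * cs.simple i) * cs.simple j * cs.simple i := by
            simp only [mul_assoc]
        _ = _ := by rw [this]; simp [mul_assoc]
    have s1 := cs.length_mul_simple (cs.wordProd κ) i
    have s2 := cs.length_mul_simple (cs.wordProd κ * cs.simple i) j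
    have s3 := cs.length_mul_simple (cs.wordProd κ) j
    have s4 := cs.length_mul_simple (cs.wordProd κ * cs.simple j) i
    rw [r1] at s2
    rw [r2] at s4
    have hκe := hκ.eq
    have t1 := key2 κ i hκ (by omega)
    have t3 := key2 κ j hκ (by omega)
    have p1 : cs.wordProd (κ ++ [i]) = cs.wordProd κ * cs.simple i := by
      simp [cs.wordProd_append]
    have p3 : cs.wordProd (κ ++ [j]) = cs.wordProd κ * cs.simple j := by
      simp [cs.wordProd_append]
    have t2 := key2 (κ ++ [i]) j t1 (by rw [p1, r1]; simp; omega)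
    have t4 := key2 (κ ++ [j]) i t3 (by rw [p3, r2]; simp; omega)
    have q1 := ih ρ.length (by omega) ρ (κ ++ [i] ++ [j]) rfl a1 t2
      (by rw [cs.wordProd_append, p1]; simp [r1, hwi])
    have q2 := ih ρ'.length (by omega) ρ' (κ ++ [j] ++ [i]) rfl b1 t4
      (by rw [cs.wordProd_append, p3]; simp [r2, hwj])
    simp only [List.map_append, List.prod_append, q1, q2]
    have := hb i j hij h1
    simp only [mul_assoc] at this
    simp [mul_assoc, this]


theorem pow_finrank_zero {a : Module.End ℂ L} (ha : IsNilpotent a) :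
    a ^ Module.finrank ℂ L = 0 := by
  have h1 := LinearMap.aeval_self_charpoly a
  rw [ha.charpoly_eq_X_pow_finrank] at h1
  simpa using h1

theorem expEnd_apply_of {a : Module.End ℂ L} (ha : IsNilpotent a) (x : L) (k : ℕ)
    (hk : (a ^ k) x = 0) :
    expEnd a x = ∑ n ∈ Finset.range k, (n.factorial : ℂ)⁻¹ • (a ^ n) x := by
  have hz : ∀ n, k ≤ n → (a ^ n) x = 0 := by
    intro n hn
    obtain ⟨m, rfl⟩ := Nat.exists_eq_add_of_le hn
    rw [add_comm, pow_add, Module.End.mul_apply, hk, map_zero]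
  have hz' : ∀ n, Module.finrank ℂ L + 1 ≤ n → (a ^ n) x = 0 := by
    intro n hn
    rw [pow_eq_zero_of_le (by omega) (pow_finrank_zero ha), LinearMap.zero_apply]
  unfold expEnd
  rw [LinearMap.sum_apply]
  simp only [LinearMap.smul_apply]
  rw [Finset.sum_subset (Finset.range_mono (Nat.le_add_right (Module.finrank ℂ L + 1) k))]
  · symm
    apply Finset.sum_subset (Finset.range_mono (Nat.le_add_left _ _))
    intro n _ hn
    rw [hz n (by simpa using hn), smul_zero]
  · intro n _ hn
    rw [hz' n (by simpa using hn), smul_zero]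

theorem expEnd_lie (x : L) (hx : IsNilpotent (LieAlgebra.ad ℂ L x)) (y z : L) :
    expEnd (LieAlgebra.ad ℂ L x) ⁅y, z⁆ =
      ⁅expEnd (LieAlgebra.ad ℂ L x) y, expEnd (LieAlgebra.ad ℂ L x) z⁆ := by
  letI : Module ℚ L := Module.compHom L (algebraMap ℚ ℂ)
  haveI : IsScalarTower ℚ ℂ L := ⟨fun q c v => by
    change (q • c) • v = (algebraMap ℚ ℂ q) • (c • v)
    rw [Algebra.smul_def, mul_smul]⟩
  letI : LieAlgebra ℚ L := 
    { lie_smul := fun q u v => lie_smul (algebraMap ℚ ℂ q) u v }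
  have hD : (LieDerivation.ad ℂ L x).toLinearMap = LieAlgebra.ad ℂ L x := by
    ext; simp
  have hx' : IsNilpotent (LieDerivation.ad ℂ L x).toLinearMap := by rw [hD]; exact hx
  have key : ∀ v, LieDerivation.exp (LieDerivation.ad ℂ L x) hx' v =
      expEnd (LieAlgebra.ad ℂ L x) v := by
    intro v
    rw [LieDerivation.exp_map_apply, hD,
      IsNilpotent.exp_eq_sum (pow_eq_zero_of_le (Nat.le_succ _) (pow_finrank_zero hx))]
    unfold expEnd
    rw [LinearMap.sum_apply, LinearMap.sum_apply]
    refine Finset.sum_congr rfl fun n _ => ?_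
    rw [LinearMap.smul_apply, LinearMap.smul_apply]
    change (algebraMap ℚ ℂ (n.factorial : ℚ)⁻¹) • ((LieAlgebra.ad ℂ L x ^ n) v) = _
    simp
  simp only [← key, LieEquiv.map_lie]

theorem expEnd_three {a : Module.End ℂ L} (ha : IsNilpotent a) {x y z : L}
    (h1 : a x = y) (h2 : a y = z) (h3 : a z = 0) :
    expEnd a x = x + y + (2 : ℂ)⁻¹ • z := by
  rw [expEnd_apply_of ha x 3 (by simp [pow_succ, h1, h2, h3])]
  simp [Finset.sum_range_succ, pow_succ, h1, h2]

theorem expEnd_two {a : Module.End ℂ L} (ha : IsNilpotent a) {x y : L}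
    (h1 : a x = y) (h2 : a y = 0) : expEnd a x = x + y := by
  rw [expEnd_three ha h1 h2 (map_zero a)]; simp

theorem expEnd_one {a : Module.End ℂ L} (ha : IsNilpotent a) {x : L}
    (h1 : a x = 0) : expEnd a x = x := by
  rw [expEnd_two ha h1 (map_zero a)]; simp

theorem conj_exp (φ : Module.End ℂ L) (hφ : ∀ y z, φ ⁅y, z⁆ = ⁅φ y, φ z⁆)
    (a b : Module.End ℂ L) (hab : φ * a = b * φ) :
    φ * expEnd a = expEnd b * φ := by
  have hp : ∀ n : ℕ, φ * a ^ n = b ^ n * φ := by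
    intro n
    induction n with
    | zero => simp
    | succ n ih => rw [pow_succ, ← mul_assoc, ih, mul_assoc, hab, pow_succ, mul_assoc]
  unfold expEnd
  rw [Finset.mul_sum, Finset.sum_mul]
  refine Finset.sum_congr rfl fun n _ => ?_
  rw [mul_smul_comm, hp, smul_mul_assoc]

theorem conj_tau (e f : I → L) (i j : I) (φ : Module.End ℂ L)
    (hφ : ∀ y z, φ ⁅y, z⁆ = ⁅φ y, φ z⁆) (he : φ (e i) = e j) (hf : φ (f i) = f j) :
    φ * chevalleyTau e f i = chevalleyTau e f j * φ := by
  have h1 := conj_exp φ hφ (LieAlgebra.ad ℂ L (e i)) (LieAlgebra.ad ℂ L (e j))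
    (LinearMap.ext fun v => by simp [hφ, he])
  have h2 := conj_exp φ hφ (-LieAlgebra.ad ℂ L (f i)) (-LieAlgebra.ad ℂ L (f j))
    (LinearMap.ext fun v => by simp [hφ, hf])
  unfold chevalleyTau
  rw [← mul_assoc, ← mul_assoc, h1, mul_assoc _ φ, h2, ← mul_assoc, mul_assoc _ φ, h1,
    ← mul_assoc]

section Chev

variable {A : Matrix I I ℤ} {e f h : I → L} (H : IsChevalleySystem A e f h)

theorem tau_apply (i : I) (x : L) : chevalleyTau e f i x =
    expEnd (LieAlgebra.ad ℂ L (e i)) (expEnd (-(LieAlgebra.ad ℂ L (f i)))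
      (expEnd (LieAlgebra.ad ℂ L (e i)) x)) := rfl

theorem tau_lie (H : IsChevalleySystem A e f h) (i : I) (y z : L) :
    chevalleyTau e f i ⁅y, z⁆ = ⁅chevalleyTau e f i y, chevalleyTau e f i z⁆ := by
  have hn : -(LieAlgebra.ad ℂ L (f i)) = LieAlgebra.ad ℂ L (-f i) := by rw [map_neg]
  have hf' : IsNilpotent (LieAlgebra.ad ℂ L (-f i)) := by
    rw [← hn]; exact (H.ad_f_nilpotent i).neg
  simp only [tau_apply, hn, expEnd_lie _ hf', expEnd_lie _ (H.ad_e_nilpotent i)]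

theorem lie_e_f_self (H : IsChevalleySystem A e f h) (i : I) : ⁅e i, f i⁆ = h i := by
  simp [H.lie_e_f]

theorem lie_f_e_self (H : IsChevalleySystem A e f h) (i : I) : ⁅f i, e i⁆ = -h i := by
  rw [← lie_skew, lie_e_f_self H]

theorem lie_e_h (H : IsChevalleySystem A e f h) (i : I) : ⁅e i, h i⁆ = -(2 : ℂ) • e i := by
  rw [← lie_skew, H.lie_h_e, H.cartan.diag]; simp

theorem lie_f_h (H : IsChevalleySystem A e f h) (i : I) : ⁅f i, h i⁆ = (2 : ℂ) • f i := by
  rw [← lie_skew, H.lie_h_f, H.cartan.diag]; simp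

theorem exp_e_f (H : IsChevalleySystem A e f h) (i : I) :
    expEnd (LieAlgebra.ad ℂ L (e i)) (f i) = f i + h i - e i := by
  rw [expEnd_three (H.ad_e_nilpotent i) (y := h i) (z := -(2 : ℂ) • e i)
    (by simp [lie_e_f_self H]) (by simp [lie_e_h H]) (by simp)]
  module

theorem exp_e_e (H : IsChevalleySystem A e f h) (i : I) :
    expEnd (LieAlgebra.ad ℂ L (e i)) (e i) = e i :=
  expEnd_one (H.ad_e_nilpotent i) (by simp)

theorem exp_e_h (H : IsChevalleySystem A e f h) (i : I) :
    expEnd (LieAlgebra.ad ℂ L (e i)) (h i) = h i - (2 : ℂ) • e i := by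
  rw [expEnd_two (H.ad_e_nilpotent i) (y := -(2 : ℂ) • e i)
    (by simp [lie_e_h H]) (by simp)]
  module

theorem exp_f_e (H : IsChevalleySystem A e f h) (i : I) :
    expEnd (-LieAlgebra.ad ℂ L (f i)) (e i) = e i + h i - f i := by
  rw [expEnd_three (H.ad_f_nilpotent i).neg (y := h i) (z := -(2 : ℂ) • f i)
    (by simp [lie_f_e_self H]) (by simp [lie_f_h H]) (by simp)]
  module

theorem exp_f_f (H : IsChevalleySystem A e f h) (i : I) :
    expEnd (-LieAlgebra.ad ℂ L (f i)) (f i) = f i :=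
  expEnd_one (H.ad_f_nilpotent i).neg (by simp)

theorem exp_f_h (H : IsChevalleySystem A e f h) (i : I) :
    expEnd (-LieAlgebra.ad ℂ L (f i)) (h i) = h i - (2 : ℂ) • f i := by
  rw [expEnd_two (H.ad_f_nilpotent i).neg (y := -(2 : ℂ) • f i)
    (by simp [lie_f_h H]) (by simp)]
  module

theorem tau_e_self (H : IsChevalleySystem A e f h) (i : I) :
    chevalleyTau e f i (e i) = -f i := by
  rw [tau_apply, exp_e_e H, exp_f_e H, map_sub, map_add, exp_e_e H, exp_e_h H, exp_e_f H]
  module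

theorem tau_f_self (H : IsChevalleySystem A e f h) (i : I) :
    chevalleyTau e f i (f i) = -e i := by
  rw [tau_apply, exp_e_f H, map_sub, map_add, exp_f_e H, exp_f_h H, exp_f_f H]
  have : f i + (h i - (2 : ℂ) • f i) - (e i + h i - f i) = -e i := by module
  rw [this, map_neg, exp_e_e H]

theorem lie_e_f_ne (H : IsChevalleySystem A e f h) {i j : I} (hij : i ≠ j) :
    ⁅e i, f j⁆ = 0 := by
  simp [H.lie_e_f, hij]

theorem lie_f_e_ne (H : IsChevalleySystem A e f h) {i j : I} (hij : i ≠ j) :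
    ⁅f i, e j⁆ = 0 := by
  rw [← lie_skew, lie_e_f_ne H hij.symm, neg_zero]

theorem tau_e_comm (H : IsChevalleySystem A e f h) {i j : I} (hij : i ≠ j) (h0 : A i j = 0) :
    chevalleyTau e f i (e j) = e j := by
  have hs : ⁅e i, e j⁆ = 0 := by simpa [h0] using H.serre_e i j hij
  have h1 : expEnd (LieAlgebra.ad ℂ L (e i)) (e j) = e j :=
    expEnd_one (H.ad_e_nilpotent i) (by simp [hs])
  have h2 : expEnd (-LieAlgebra.ad ℂ L (f i)) (e j) = e j :=
    expEnd_one (H.ad_f_nilpotent i).neg (by simp [lie_f_e_ne H hij])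
  rw [tau_apply, h1, h2, h1]

theorem tau_f_comm (H : IsChevalleySystem A e f h) {i j : I} (hij : i ≠ j) (h0 : A i j = 0) :
    chevalleyTau e f i (f j) = f j := by
  have hs : ⁅f i, f j⁆ = 0 := by simpa [h0] using H.serre_f i j hij
  have h1 : expEnd (LieAlgebra.ad ℂ L (e i)) (f j) = f j :=
    expEnd_one (H.ad_e_nilpotent i) (by simp [lie_e_f_ne H hij])
  have h2 : expEnd (-LieAlgebra.ad ℂ L (f i)) (f j) = f j :=
    expEnd_one (H.ad_f_nilpotent i).neg (by simp [hs])
  rw [tau_apply, h1, h2, h1]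

theorem lie_f_ee (H : IsChevalleySystem A e f h) {i j : I} (hij : i ≠ j) (h1 : A i j = -1) :
    ⁅f i, ⁅e i, e j⁆⁆ = e j := by
  rw [leibniz_lie, lie_f_e_self H, lie_f_e_ne H hij, neg_lie, H.lie_h_e, h1]; simp

theorem lie_e_ff (H : IsChevalleySystem A e f h) {i j : I} (hij : i ≠ j) (h1 : A i j = -1) :
    ⁅e i, ⁅f i, f j⁆⁆ = f j := by
  rw [leibniz_lie, lie_e_f_self H, lie_e_f_ne H hij, H.lie_h_f, h1]; simp

theorem serre_e' (H : IsChevalleySystem A e f h) {i j : I} (hij : i ≠ j) (h1 : A i j = -1) :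
    ⁅e i, ⁅e i, e j⁆⁆ = 0 := by
  have := H.serre_e i j hij
  rw [h1] at this
  simpa [pow_succ] using this

theorem serre_f' (H : IsChevalleySystem A e f h) {i j : I} (hij : i ≠ j) (h1 : A i j = -1) :
    ⁅f i, ⁅f i, f j⁆⁆ = 0 := by
  have := H.serre_f i j hij
  rw [h1] at this
  simpa [pow_succ] using this

theorem tau_e_adj (H : IsChevalleySystem A e f h) {i j : I} (hij : i ≠ j) (h1 : A i j = -1) :
    chevalleyTau e f i (e j) = ⁅e i, e j⁆ := by
  have q1 : expEnd (LieAlgebra.ad ℂ L (e i)) (e j) = e j + ⁅e i, e j⁆ :=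
    expEnd_two (H.ad_e_nilpotent i) (by simp) (by simp [serre_e' H hij h1])
  have q2 : expEnd (-LieAlgebra.ad ℂ L (f i)) (e j) = e j :=
    expEnd_one (H.ad_f_nilpotent i).neg (by simp [lie_f_e_ne H hij])
  have q3 : expEnd (-LieAlgebra.ad ℂ L (f i)) ⁅e i, e j⁆ = ⁅e i, e j⁆ + -e j :=
    expEnd_two (H.ad_f_nilpotent i).neg (by simp [lie_f_ee H hij h1])
      (by simp [lie_f_e_ne H hij])
  have q4 : expEnd (LieAlgebra.ad ℂ L (e i)) ⁅e i, e j⁆ = ⁅e i, e j⁆ :=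
    expEnd_one (H.ad_e_nilpotent i) (by simp [serre_e' H hij h1])
  rw [tau_apply, q1, map_add, q2, q3]
  have : e j + (⁅e i, e j⁆ + -e j) = ⁅e i, e j⁆ := by abel
  rw [this, q4]

theorem tau_f_adj (H : IsChevalleySystem A e f h) {i j : I} (hij : i ≠ j) (h1 : A i j = -1) :
    chevalleyTau e f i (f j) = -⁅f i, f j⁆ := by
  have q1 : expEnd (LieAlgebra.ad ℂ L (e i)) (f j) = f j :=
    expEnd_one (H.ad_e_nilpotent i) (by simp [lie_e_f_ne H hij])
  have q2 : expEnd (-LieAlgebra.ad ℂ L (f i)) (f j) = f j + -⁅f i, f j⁆ :=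
    expEnd_two (H.ad_f_nilpotent i).neg
      (by rw [LinearMap.neg_apply, LieAlgebra.ad_apply])
      (by rw [LinearMap.neg_apply, map_neg, LieAlgebra.ad_apply, serre_f' H hij h1]; simp)
  have q3 : expEnd (LieAlgebra.ad ℂ L (e i)) ⁅f i, f j⁆ = ⁅f i, f j⁆ + f j :=
    expEnd_two (H.ad_e_nilpotent i) (by simp [lie_e_ff H hij h1])
      (by simp [lie_e_f_ne H hij])
  rw [tau_apply, q1, q2, map_add, map_neg, q1, q3]
  abel

theorem tau_tau_e (H : IsChevalleySystem A e f h) {i j : I} (hij : i ≠ j) (h1 : A i j = -1) :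
    chevalleyTau e f i (chevalleyTau e f j (e i)) = e j := by
  have h1' : A j i = -1 := by rw [H.cartan.symm, h1]
  rw [tau_e_adj H hij.symm h1', tau_lie H, tau_e_adj H hij h1, tau_e_self H, lie_neg, lie_skew,
    lie_f_ee H hij h1]

theorem tau_tau_f (H : IsChevalleySystem A e f h) {i j : I} (hij : i ≠ j) (h1 : A i j = -1) :
    chevalleyTau e f i (chevalleyTau e f j (f i)) = f j := by
  have h1' : A j i = -1 := by rw [H.cartan.symm, h1]
  rw [tau_f_adj H hij.symm h1', map_neg, tau_lie H, tau_f_adj H hij h1, tau_f_self H, lie_neg,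
    neg_lie, neg_neg, lie_skew, lie_e_ff H hij h1]

theorem tau_comm (H : IsChevalleySystem A e f h) (i j : I) (hij : i ≠ j) (h0 : A i j = 0) :
    chevalleyTau e f i * chevalleyTau e f j = chevalleyTau e f j * chevalleyTau e f i :=
  conj_tau e f j j _ (tau_lie H i) (tau_e_comm H hij h0) (tau_f_comm H hij h0)

theorem tau_braid (H : IsChevalleySystem A e f h) (i j : I) (hij : i ≠ j) (h1 : A i j = -1) :
    chevalleyTau e f i * chevalleyTau e f j * chevalleyTau e f i =
      chevalleyTau e f j * chevalleyTau e f i * chevalleyTau e f j := by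
  rw [mul_assoc (chevalleyTau e f j)]
  exact conj_tau e f i j (chevalleyTau e f i * chevalleyTau e f j)
    (fun y z => by simp only [Module.End.mul_apply, tau_lie H])
    (tau_tau_e H hij h1) (tau_tau_f H hij h1)

end Chev

theorem exists_T {A : Matrix I I ℤ} {e f h : I → L} (H : IsChevalleySystem A e f h)
    {W : Type*} [Group W] (cs : CoxeterSystem (coxeterMatrixOfCartan A) W) :
    ∃ T : W → Module.End ℂ L, (∀ ω, cs.IsReduced ω → tauWord e f ω = T (cs.wordProd ω)) ∧
      T 1 = 1 ∧ ∀ u k, cs.length u < cs.length (u * cs.simple k) →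
        T (u * cs.simple k) = T u * chevalleyTau e f k := by
  choose g hg1 hg2 using cs.exists_isReduced
  have hT : ∀ ω, cs.IsReduced ω → tauWord e f ω = tauWord e f (g (cs.wordProd ω)) :=
    fun ω hω => matsumoto H.cartan cs (chevalleyTau e f) (tau_comm H) (tau_braid H) _ _ _ rfl
      hω (hg1 _) (hg2 _)
  refine ⟨fun w => tauWord e f (g w), hT, ?_, ?_⟩
  · have := hT [] (by simp [CoxeterSystem.IsReduced])
    rw [cs.wordProd_nil] at this
    beta_reduce; rw [← this]; simp [tauWord]
  · intro u k hk
    have h2 := cs.length_mul_simple u k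
    have hw : cs.wordProd (g u ++ [k]) = u * cs.simple k := by
      rw [cs.wordProd_append, ← hg2]; simp
    have hr : cs.IsReduced (g u ++ [k]) := by
      have h3 := (hg1 u).eq
      rw [← hg2] at h3
      unfold CoxeterSystem.IsReduced
      rw [hw]; simp; omega
    have := hT _ hr
    rw [hw] at this
    beta_reduce; rw [← this]
    simp [tauWord]

theorem T_simple {A : Matrix I I ℤ} {e f h : I → L} (H : IsChevalleySystem A e f h)
    {W : Type*} [Group W] (cs : CoxeterSystem (coxeterMatrixOfCartan A) W)
    (T : W → Module.End ℂ L) (T1 : T 1 = 1)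
    (Tm : ∀ u k, cs.length u < cs.length (u * cs.simple k) →
        T (u * cs.simple k) = T u * chevalleyTau e f k) :
    ∀ (n : ℕ) (w : W) (i j : I), cs.length w = n → rep H.cartan cs w (rt i) = rt j →
      T w (e i) = e j ∧ T w (f i) = f j := by
  have hA := H.cartan
  intro n
  induction n using Nat.strong_induction_on with
  | _ n ih =>
  intro w i j hn hw
  by_cases hw1 : w = 1
  · subst hw1
    have hij : i = j := by
      rw [map_one] at hw
      by_contra hne
      have := congrFun hw i
      simp [rt, hne] at this
    subst hij
    simp [T1]
  obtain ⟨k, hk⟩ := cs.exists_rightDescent_of_ne_one hw1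
  have hk' := hk
  rw [cs.isRightDescent_iff] at hk'
  have hki : k ≠ i := by
    rintro rfl
    have := rep_nonpos hA cs w k hk
    rw [hw] at this
    have := this j
    simp [rt] at this
  obtain ⟨u, hu⟩ : ∃ u, u = w * cs.simple k := ⟨_, rfl⟩
  have hwu : w = u * cs.simple k := by rw [hu]; simp
  rw [← hu] at hk'
  have huk : cs.length u < cs.length (u * cs.simple k) := by rw [← hwu]; omega
  have hTw : T w = T u * chevalleyTau e f k := by rw [hwu, Tm u k huk]
  rcases hA.off_diag k i hki with h0 | h1
  · rw [hwu, rep_mul_rt, h0, zero_smul, sub_zero] at hw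
    rw [hTw, Module.End.mul_apply, Module.End.mul_apply, tau_e_comm H hki h0,
      tau_f_comm H hki h0]
    exact ih _ (by omega) u i j rfl hw
  · have hik : A i k = -1 := by rw [hA.symm, h1]
    rcases cs.length_mul_simple u i with hi | hi
    · exfalso
      have e1 := rep_nonneg' hA cs u i (by omega)
      have e2 := rep_nonneg' hA cs u k huk
      rw [hwu, rep_mul_rt, h1, neg_smul, one_smul, sub_neg_eq_add] at hw
      have n1 : rep hA cs u (rt i) ≠ 0 := fun hh => rt_ne i (rep_inj hA cs u _ hh)
      have n2 : rep hA cs u (rt k) ≠ 0 := fun hh => rt_ne k (rep_inj hA cs u _ hh)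
      generalize rep hA cs u (rt i) = x at *
      generalize rep hA cs u (rt k) = y at *
      have hoff : ∀ m, m ≠ j → x m = 0 ∧ y m = 0 := by
        intro m hm
        have q1 := e1 m
        have q2 := e2 m
        have q3 := congrFun hw m
        simp [rt, hm] at q1 q2 q3
        omega
      have q1 := e1 j
      have q2 := e2 j
      have q3 := congrFun hw j
      simp [rt] at q1 q2 q3
      have : x j = 0 ∨ y j = 0 := by omega
      rcases this with hz | hz
      · apply n1; funext m
        by_cases hm : m = j
        · rw [hm, hz]; rfl
        · exact (hoff m hm).1
      · apply n2; funext m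
        by_cases hm : m = j
        · rw [hm, hz]; rfl
        · exact (hoff m hm).2
    · obtain ⟨v, hv⟩ : ∃ v, v = u * cs.simple i := ⟨_, rfl⟩
      have huv : u = v * cs.simple i := by rw [hv]; simp
      rw [← hv] at hi
      have hTu : T u = T v * chevalleyTau e f i := by
        rw [huv]; exact Tm v i (by rw [← huv]; omega)
      have hvk : rep hA cs v (rt k) = rt j := by
        rw [← hw, hwu, rep_mul_rt, h1, huv, rep_mul_self, rep_mul_rt, hik]; module
      rw [hTw, hTu]
      simp only [Module.End.mul_apply]
      rw [tau_tau_e H hki.symm hik, tau_tau_f H hki.symm hik]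
      exact ih _ (by omega) v k j rfl hvk

theorem longest_sq {A : Matrix I I ℤ} (hA : IsADECartanMatrix A)
    {W : Type*} [Group W] (cs : CoxeterSystem (coxeterMatrixOfCartan A) W)
    (w₀ : W) (hw₀ : ∀ w : W, cs.length w ≤ cs.length w₀) : w₀ * w₀ = 1 := by
  have hneg : ∀ i, rep hA cs w₀ (rt i) ≤ 0 := fun i =>
    rep_nonpos hA cs w₀ i (lt_of_le_of_ne (hw₀ _) (cs.length_mul_simple_ne _ _))
  have hneg2 : ∀ v : I → ℤ, v ≤ 0 → 0 ≤ rep hA cs w₀ v := by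
    intro v hv
    have : v = ∑ k, v k • rt k := by
      funext m; simp [rt, Finset.sum_apply, Pi.single_apply]
    rw [this, map_sum]
    refine Finset.sum_nonneg fun k _ => ?_
    rw [map_smul]
    exact smul_nonneg_of_nonpos_of_nonpos (hv k) (hneg k)
  by_contra hne
  obtain ⟨k, hk⟩ := cs.exists_rightDescent_of_ne_one hne
  have h1 := rep_nonpos hA cs _ k hk
  have h2 := hneg2 _ (hneg k)
  rw [← Module.End.mul_apply, ← map_mul] at h2
  exact rt_ne k (rep_inj hA cs _ _ (le_antisymm h1 h2))

theorem rep_eq_of_conj {A : Matrix I I ℤ} (hA : IsADECartanMatrix A)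
    {W : Type*} [Group W] (cs : CoxeterSystem (coxeterMatrixOfCartan A) W)
    (u : W) (i j : I) (hlt : cs.length u < cs.length (u * cs.simple i))
    (hc : u * cs.simple i = cs.simple j * u) : rep hA cs u (rt i) = rt j := by
  have hp := rep_nonneg' hA cs u i hlt
  have h1 := rep_mul_self hA cs u i
  rw [hc, map_mul, Module.End.mul_apply, rep_simple, sR_apply] at h1
  have hpre : rep hA cs u⁻¹ (rep hA cs u (rt i)) = rt i := by
    rw [← Module.End.mul_apply, ← map_mul, inv_mul_cancel, map_one, Module.End.one_apply]
  generalize rep hA cs u (rt i) = x at *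
  generalize aF A j x = d at *
  have hx : x = x j • rt j := by
    funext m
    have := congrFun h1 m
    by_cases hm : m = j
    · subst hm; simp [rt]
    · simp [rt, hm] at this ⊢
      omega
  rw [hx, map_smul] at hpre
  have h2 := congrFun hpre i
  simp [rt] at h2
  have h3 : x j = 1 := Int.eq_one_of_mul_eq_one_right (hp j) h2
  rw [hx, h3, one_smul]

end TauAux

/-- for every reduced expression `w₀ = s_{i₁} s_{i₂} ⋯ s_{i_l}` of the
longest element of the Weyl group `W`, the automorphism `τ = τ_{i₁} ∘ τ_{i₂} ∘ ⋯ ∘ τ_{i_l}`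
of `L` satisfies `τ(e_{iˇ}) = −fᵢ` for every `i`, where `iˇ` is defined by
`α_{iˇ} = −w₀(αᵢ)`, i.e. `w₀ sᵢ w₀⁻¹ = s_{iˇ}`. -/
theorem tauWord_longest_element_on_e
    (A : Matrix I I ℤ) (e f h : I → L) (hCS : IsChevalleySystem A e f h)
    {W : Type*} [Group W] [Finite W]
    (cs : CoxeterSystem (coxeterMatrixOfCartan A) W)
    (w₀ : W) (hw₀ : ∀ w : W, cs.length w ≤ cs.length w₀)
    (ω : List I) (hprod : cs.wordProd ω = w₀) (hred : cs.IsReduced ω) :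
    ∀ i iv : I, w₀ * cs.simple i * w₀⁻¹ = cs.simple iv →
      tauWord e f ω (e iv) = -(f i) := by
  intro i iv hconj
  have hA := hCS.cartan
  obtain ⟨T, hT, T1, Tm⟩ := TauAux.exists_T hCS cs
  have hsq := TauAux.longest_sq hA cs w₀ hw₀
  have hinv : w₀⁻¹ = w₀ := inv_eq_of_mul_eq_one_left hsq
  have hc : w₀ * cs.simple iv = cs.simple i * w₀ := by
    rw [← hconj, hinv]
    calc _ = (w₀ * w₀) * cs.simple i * w₀ := by simp only [mul_assoc]
      _ = _ := by rw [hsq, one_mul]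
  obtain ⟨u, hu⟩ : ∃ u, u = w₀ * cs.simple iv := ⟨_, rfl⟩
  have hwu : w₀ = u * cs.simple iv := by rw [hu]; simp
  have hlt : cs.length u < cs.length (u * cs.simple iv) := by
    rw [← hwu, hu]
    exact lt_of_le_of_ne (hw₀ _) (cs.length_mul_simple_ne _ _)
  have hcu : u * cs.simple iv = cs.simple i * u := by
    rw [← hwu, hu, hc]; simp
  have hr := TauAux.rep_eq_of_conj hA cs u iv i hlt hcu
  have := (TauAux.T_simple hCS cs T T1 Tm _ u iv i rfl hr).2
  rw [hT ω hred, hprod, hwu, Tm u iv hlt, Module.End.mul_apply, TauAux.tau_e_self hCS,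
    map_neg, this]
end
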